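/- arXiv:1901.00043 — 12 statements merged into one kernel-verified Lean document; each statement's English description precedes it below -/
import Mathlib

section
/- Let G be a finite connected graph that is claw-free and bull-free, and let C be an induced cycle in G of length k ≥ 4. Then every vertex x of G that is not on C but has a neighbor on C is adjacent to two consecutive vertices of C, i.e., there is an index i such that x is adjacent to both v_i and v_{i+1} (indices mod k). -/
/-- A graph is claw-free: no induced `K_{1,3}`. -/
def ClawFree {V : Type*} (G : SimpleGraph V) : Prop :=
  ¬ ∃ v a b c : V, a ≠ b ∧ a ≠ c ∧ b ≠ c ∧
    G.Adj v a ∧ G.Adj v b ∧ G.Adj v c ∧ ¬ G.Adj a b ∧ ¬ G.Adj a c ∧ ¬ G.Adj b c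

/-- A graph is bull-free: no induced bull (triangle `a b c` with pendants `d` at `a`
and `e` at `b`). -/
def BullFree {V : Type*} (G : SimpleGraph V) : Prop :=
  ¬ ∃ a b c d e : V, a ≠ e ∧ b ≠ d ∧ c ≠ d ∧ c ≠ e ∧ d ≠ e ∧
    G.Adj a b ∧ G.Adj b c ∧ G.Adj c a ∧ G.Adj a d ∧ G.Adj b e ∧
    ¬ G.Adj b d ∧ ¬ G.Adj c d ∧ ¬ G.Adj a e ∧ ¬ G.Adj c e ∧ ¬ G.Adj d e
/-- `v : ZMod k → V` is an induced cycle of length `k` in `G`: the vertices are distinct and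
two of them are adjacent iff their indices differ by `±1` modulo `k`. -/
def IsInducedCycle {V : Type*} (G : SimpleGraph V) (k : ℕ) (v : ZMod k → V) : Prop :=
  Function.Injective v ∧ ∀ i j : ZMod k, G.Adj (v i) (v j) ↔ (i - j = 1 ∨ j - i = 1)

/-- In a connected (claw, bull)-free graph, every vertex with a neighbor on an induced cycle
of length `k ≥ 4` (but not on the cycle) is adjacent to two consecutive vertices of the
cycle. -/
theorem two_consecutive_neighbors_on_cycle {V : Type*} [Fintype V] (G : SimpleGraph V)
    (hconn : G.Connected) (hclaw : ClawFree G) (hbull : BullFree G)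
    (k : ℕ) (hk : 4 ≤ k) (v : ZMod k → V) (hC : IsInducedCycle G k v)
    (x : V) (hx : x ∉ Set.range v) (hxN : ∃ i : ZMod k, G.Adj x (v i)) :
    ∃ i : ZMod k, G.Adj x (v i) ∧ G.Adj x (v (i + 1)) := by
  obtain ⟨i, hi⟩ := hxN
  by_contra! h
  have hne : ∀ n : ℕ, 0 < n → n < 4 → (n : ZMod k) ≠ 0 := fun n h0 h4 hn =>
    absurd (Nat.le_of_dvd h0 ((ZMod.natCast_eq_zero_iff n k).mp hn)) (by omega)
  have h1 := hne 1 (by norm_num) (by norm_num)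
  have h2 := hne 2 (by norm_num) (by norm_num)
  have h3 := hne 3 (by norm_num) (by norm_num)
  push_cast at h1 h2 h3
  have hnext : ¬ G.Adj x (v (i + 1)) := h i hi
  have hprev : ¬ G.Adj x (v (i - 1)) := fun hp => h (i - 1) hp (by simpa using hi)
  refine hclaw ⟨v i, x, v (i + 1), v (i - 1), fun e => hx ⟨_, e.symm⟩,
    fun e => hx ⟨_, e.symm⟩, fun e => h2 ?_, hi.symm, (hC.2 _ _).2 (Or.inr (by ring)),
    (hC.2 _ _).2 (Or.inl (by ring)), hnext, hprev, fun e => ?_⟩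
  · linear_combination hC.1 e
  · rcases (hC.2 _ _).1 e with e | e
    · exact h1 (by linear_combination e)
    · exact h3 (by linear_combination -e)
end

section
/- Let G be a finite connected graph that is claw-free and bull-free, and let C be an induced cycle in G of length k ≥ 5. Then every vertex x of G that is not on C but has a neighbor on C is adjacent to three consecutive vertices of C, i.e., there is an index i such that x is adjacent to v_i, v_{i+1} and v_{i+2} (indices mod k). -/
/-- A positive natural number below `k` is nonzero in `ZMod k`. -/
theorem ZMod.natCast_ne_zero_of_pos_of_lt {k n : ℕ} (hn : 0 < n) (hnk : n < k) :
    (n : ZMod k) ≠ 0 := fun h =>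
  absurd (Nat.le_of_dvd hn ((ZMod.natCast_eq_zero_iff n k).1 h)) (not_le.2 hnk)

/-- In a bull-free graph, a vertex adjacent to two consecutive vertices of an induced cycle of
length `k ≥ 5` is adjacent to three consecutive ones. -/
theorem BullFree.three_consecutive_of_two {V : Type*} {G : SimpleGraph V} (hbull : BullFree G)
    {k : ℕ} (hk : 5 ≤ k) {v : ZMod k → V} (hC : IsInducedCycle G k v)
    {x : V} (hx : x ∉ Set.range v) {i : ZMod k}
    (h0 : G.Adj x (v i)) (h1 : G.Adj x (v (i + 1))) :
    ∃ i : ZMod k, G.Adj x (v i) ∧ G.Adj x (v (i + 1)) ∧ G.Adj x (v (i + 2)) := by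
  obtain ⟨hinj, hadj⟩ := hC
  have two : (2 : ZMod k) ≠ 0 :=
    mod_cast ZMod.natCast_ne_zero_of_pos_of_lt (n := 2) (by lia) (by lia)
  have three : (3 : ZMod k) ≠ 0 :=
    mod_cast ZMod.natCast_ne_zero_of_pos_of_lt (n := 3) (by lia) (by lia)
  have four : (4 : ZMod k) ≠ 0 :=
    mod_cast ZMod.natCast_ne_zero_of_pos_of_lt (n := 4) (by lia) (by lia)
  have one : (1 : ZMod k) ≠ 0 :=
    mod_cast ZMod.natCast_ne_zero_of_pos_of_lt (n := 1) (by lia) (by lia)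
  have hxv : ∀ j, x ≠ v j := fun j h => hx ⟨j, h.symm⟩
  by_contra! hno
  have h2 : ¬ G.Adj x (v (i + 2)) := hno i h0 h1
  have hm : ¬ G.Adj x (v (i - 1)) := fun h => by
    have := hno (i - 1) h
    rw [sub_add_cancel, show i - 1 + 2 = i + 1 by ring] at this
    exact this h0 h1
  refine hbull ⟨v i, v (i + 1), x, v (i - 1), v (i + 2), hinj.ne ?_, hinj.ne ?_, hxv _, hxv _,
    hinj.ne ?_, (hadj _ _).2 (.inr (by ring)), h1.symm, h0, (hadj _ _).2 (.inl (by ring)),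
    (hadj _ _).2 (.inr (by ring)), mt (hadj _ _).1 ?_, hm, mt (hadj _ _).1 ?_, h2,
    mt (hadj _ _).1 ?_⟩
  · exact fun h => two (by linear_combination -h)
  · exact fun h => two (by linear_combination h)
  · exact fun h => three (by linear_combination -h)
  · rintro (h | h)
    exacts [one (by linear_combination h), three (by linear_combination -h)]
  · rintro (h | h)
    exacts [three (by linear_combination -h), one (by linear_combination h)]
  · rintro (h | h)
    exacts [four (by linear_combination -h), two (by linear_combination h)]

/-- In a connected (claw, bull)-free graph, every vertex with a neighbor on an induced cycle
of length `k ≥ 5` (but not on the cycle) is adjacent to three consecutive vertices of the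
cycle. -/
theorem three_consecutive_neighbors_on_cycle {V : Type*} [Fintype V] (G : SimpleGraph V)
    (hconn : G.Connected) (hclaw : ClawFree G) (hbull : BullFree G)
    (k : ℕ) (hk : 5 ≤ k) (v : ZMod k → V) (hC : IsInducedCycle G k v)
    (x : V) (hx : x ∉ Set.range v) (hxN : ∃ i : ZMod k, G.Adj x (v i)) :
    ∃ i : ZMod k, G.Adj x (v i) ∧ G.Adj x (v (i + 1)) ∧ G.Adj x (v (i + 2)) := by
  obtain ⟨i, hi⟩ := hxN
  have hxv : ∀ j, x ≠ v j := fun j h => hx ⟨j, h.symm⟩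
  by_cases hs : G.Adj x (v (i + 1))
  · exact hbull.three_consecutive_of_two hk hC hx hi hs
  by_cases hp : G.Adj x (v (i - 1))
  · exact hbull.three_consecutive_of_two hk hC hx hp (by rwa [sub_add_cancel])
  obtain ⟨hinj, hadj⟩ := hC
  have one : (1 : ZMod k) ≠ 0 :=
    mod_cast ZMod.natCast_ne_zero_of_pos_of_lt (n := 1) (by lia) (by lia)
  have two : (2 : ZMod k) ≠ 0 :=
    mod_cast ZMod.natCast_ne_zero_of_pos_of_lt (n := 2) (by lia) (by lia)
  have three : (3 : ZMod k) ≠ 0 :=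
    mod_cast ZMod.natCast_ne_zero_of_pos_of_lt (n := 3) (by lia) (by lia)
  refine (hclaw ⟨v i, x, v (i + 1), v (i - 1), hxv _, hxv _, hinj.ne ?_, hi.symm,
    (hadj _ _).2 (.inr (by ring)), (hadj _ _).2 (.inl (by ring)), hs, hp,
    mt (hadj _ _).1 ?_⟩).elim
  · exact fun h => two (by linear_combination h)
  · rintro (h | h)
    exacts [one (by linear_combination h), three (by linear_combination -h)]
end

section
/- Let G be a finite connected graph that is claw-free and bull-free, and let C be an induced cycle in G of length k ≥ 4. Then C is dominating: every vertex of G either lies on C or is adjacent to some vertex of C. -/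
section

variable {V : Type*} {G : SimpleGraph V} {k : ℕ} {v : ZMod k → V}

theorem ZMod.natCast_ne_zero_of_lt {n : ℕ} (hn : 0 < n) (hnk : n < k) : (n : ZMod k) ≠ 0 :=
  fun h => Nat.not_dvd_of_pos_of_lt hn hnk ((ZMod.natCast_eq_zero_iff n k).1 h)

/-- Consecutive vertices of an induced cycle are adjacent. -/
theorem IsInducedCycle.adj_succ (hC : IsInducedCycle G k v) (i : ZMod k) :
    G.Adj (v i) (v (i + 1)) :=
  (hC.2 _ _).2 (Or.inr (by ring))

theorem IsInducedCycle.adj_pred (hC : IsInducedCycle G k v) (i : ZMod k) :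
    G.Adj (v i) (v (i - 1)) :=
  (hC.2 _ _).2 (Or.inl (by ring))

/-- The two neighbours of a vertex on an induced cycle of length at least four are distinct. -/
theorem IsInducedCycle.pred_ne_succ (hC : IsInducedCycle G k v) (hk : 4 ≤ k) (i : ZMod k) :
    v (i - 1) ≠ v (i + 1) := by
  intro h
  have h2 := ZMod.natCast_ne_zero_of_lt (k := k) (n := 2) (by omega) (by omega)
  push_cast at h2
  exact h2 (by linear_combination -hC.1 h)

/-- The two neighbours of a vertex on an induced cycle of length at least four are nonadjacent. -/
theorem IsInducedCycle.not_adj_pred_succ (hC : IsInducedCycle G k v) (hk : 4 ≤ k) (i : ZMod k) :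
    ¬ G.Adj (v (i - 1)) (v (i + 1)) := by
  intro h
  have h1 := ZMod.natCast_ne_zero_of_lt (k := k) (n := 1) (by omega) (by omega)
  have h3 := ZMod.natCast_ne_zero_of_lt (k := k) (n := 3) (by omega) (by omega)
  push_cast at h1 h3
  rcases (hC.2 _ _).1 h with h | h
  · exact h3 (by linear_combination -h)
  · exact h1 (by linear_combination h)

/-- In a claw-free graph, a vertex off an induced cycle with a neighbour on it is adjacent to two
consecutive vertices of the cycle. -/
theorem IsInducedCycle.exists_adj_adj_succ (hC : IsInducedCycle G k v) (hk : 4 ≤ k)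
    (hclaw : ClawFree G) {u : V} (hu : u ∉ Set.range v) {i : ZMod k} (hi : G.Adj u (v i)) :
    ∃ j, G.Adj u (v j) ∧ G.Adj u (v (j + 1)) := by
  by_contra! hn
  have hp : ¬ G.Adj u (v (i - 1)) := fun h => hn (i - 1) h (by rwa [sub_add_cancel])
  exact hclaw ⟨v i, u, v (i - 1), v (i + 1), fun h => hu ⟨_, h.symm⟩, fun h => hu ⟨_, h.symm⟩,
    hC.pred_ne_succ hk i, hi.symm, hC.adj_pred i, hC.adj_succ i, hp, hn i hi,
    hC.not_adj_pred_succ hk i⟩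

/-- Being dominated by an induced cycle propagates along edges. -/
theorem IsInducedCycle.dominated_of_adj (hC : IsInducedCycle G k v) (hk : 4 ≤ k)
    (hclaw : ClawFree G) (hbull : BullFree G) {u w : V} (huw : G.Adj u w)
    (hu : u ∈ Set.range v ∨ ∃ i, G.Adj u (v i)) :
    w ∈ Set.range v ∨ ∃ i, G.Adj w (v i) := by
  by_contra! hw
  obtain ⟨hwC, hwn⟩ := hw
  have huC : u ∉ Set.range v := by
    rintro ⟨i, rfl⟩
    exact hwn i huw.symm
  have hwne : ∀ i, w ≠ v i := fun i h => hwC ⟨i, h.symm⟩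
  obtain ⟨i, hi⟩ := hu.resolve_left huC
  obtain ⟨j, hj, hj'⟩ := hC.exists_adj_adj_succ hk hclaw huC hi
  have hup : ¬ G.Adj u (v (j - 1)) := fun h =>
    hclaw ⟨u, w, v (j - 1), v (j + 1), hwne _, hwne _, hC.pred_ne_succ hk j, huw, h, hj',
      hwn _, hwn _, hC.not_adj_pred_succ hk j⟩
  exact hbull ⟨u, v j, v (j + 1), w, v (j - 1), fun h => huC ⟨_, h.symm⟩, (hwne _).symm,
    (hwne _).symm, (hC.pred_ne_succ hk j).symm, hwne _, hj, hC.adj_succ j, hj'.symm, huw,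
    hC.adj_pred j, fun h => hwn _ h.symm, fun h => hwn _ h.symm, hup,
    fun h => hC.not_adj_pred_succ hk j h.symm, hwn _⟩

end

/-- In a connected (claw, bull)-free graph, any induced cycle of length `k ≥ 4` is
dominating: every vertex is on the cycle or adjacent to a vertex of the cycle. -/
theorem induced_cycle_dominating {V : Type*} [Fintype V] (G : SimpleGraph V)
    (hconn : G.Connected) (hclaw : ClawFree G) (hbull : BullFree G)
    (k : ℕ) (hk : 4 ≤ k) (v : ZMod k → V) (hC : IsInducedCycle G k v) :
    ∀ x : V, x ∈ Set.range v ∨ ∃ i : ZMod k, G.Adj x (v i) := by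
  intro x
  have h := (SimpleGraph.reachable_iff_reflTransGen _ _).1 (hconn.preconnected (v 0) x)
  induction h with
  | refl => exact Or.inl ⟨0, rfl⟩
  | tail _ hadj ih => exact hC.dominated_of_adj hk hclaw hbull hadj ih
end

section
/- Let G be a finite connected graph that is claw-free and bull-free, and let C be an induced cycle in G of length k ≥ 6. If x and y are distinct vertices of G that have at least two common neighbors among the vertices of C, then x and y are adjacent. -/
/-- `w` is a walk indexed by `ℤ` that looks like an induced path on every six consecutive indices,
and whose image is closed under taking neighbours along the walk. -/
structure IsUnrolledCycle {V : Type*} (G : SimpleGraph V) (w : ℤ → V) : Prop where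
  ne : ∀ a b : ℤ, 1 ≤ b - a → b - a ≤ 5 → w a ≠ w b
  adj : ∀ a b : ℤ, b = a + 1 → G.Adj (w a) (w b)
  not_adj : ∀ a b : ℤ, 2 ≤ b - a → b - a ≤ 4 → ¬ G.Adj (w a) (w b)
  eq_of_adj : ∀ a b : ℤ, G.Adj (w a) (w b) → w b = w (a + 1) ∨ w b = w (a - 1)

lemma IsInducedCycle.isUnrolledCycle {V : Type*} {G : SimpleGraph V} {k : ℕ} (hk : 6 ≤ k)
    {v : ZMod k → V} (hC : IsInducedCycle G k v) :
    IsUnrolledCycle G (fun z : ℤ => v (z : ZMod k)) := by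
  obtain ⟨hinj, hadj⟩ := hC
  have hcast : ∀ d : ℤ, 1 ≤ d → d ≤ 5 → (d : ZMod k) ≠ 0 := by
    intro d h1 h2 h
    have hdvd := Int.le_of_dvd (by omega) ((ZMod.intCast_zmod_eq_zero_iff_dvd d k).1 h)
    omega
  refine ⟨fun a b h1 h2 h => ?_, fun a b h => ?_, fun a b h1 h2 h => ?_, fun a b h => ?_⟩
  · refine hcast (b - a) h1 h2 ?_
    push_cast
    rw [hinj h, sub_self]
  · rw [hadj]
    right
    rw [h]
    push_cast
    ring
  · rcases (hadj _ _).1 h with h | h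
    · refine hcast (b - a + 1) (by omega) (by omega) ?_
      push_cast
      rw [← h]
      ring
    · refine hcast (b - a - 1) (by omega) (by omega) ?_
      push_cast
      rw [h]
      ring
  · rcases (hadj _ _).1 h with h | h
    · right
      congr 1
      push_cast
      rw [← h]
      ring
    · left
      congr 1
      push_cast
      rw [← h]
      ring

namespace IsUnrolledCycle

variable {V : Type*} {G : SimpleGraph V} {w : ℤ → V}

/-- Reversing the direction of an unrolled cycle. -/
lemma neg (hw : IsUnrolledCycle G w) : IsUnrolledCycle G (fun z => w (-z)) where
  ne a b h1 h2 := (hw.ne (-b) (-a) (by omega) (by omega)).symm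
  adj a b h := (hw.adj (-b) (-a) (by omega)).symm
  not_adj a b h1 h2 h := hw.not_adj (-b) (-a) (by omega) (by omega) h.symm
  eq_of_adj a b h := by
    rw [show -(a + 1) = -a - 1 by ring, show -(a - 1) = -a + 1 by ring]
    exact (hw.eq_of_adj _ _ h).symm

lemma not_adj_three (hw : IsUnrolledCycle G w) (hclaw : ClawFree G) {x : V} {a : ℤ}
    (h1 : G.Adj x (w a)) (h2 : G.Adj x (w (a + 2))) (h3 : G.Adj x (w (a + 4))) : False :=
  hclaw ⟨x, _, _, _, hw.ne a (a + 2) (by omega) (by omega), hw.ne a (a + 4) (by omega) (by omega),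
    hw.ne (a + 2) (a + 4) (by omega) (by omega), h1, h2, h3,
    hw.not_adj _ _ (by omega) (by omega), hw.not_adj _ _ (by omega) (by omega),
    hw.not_adj _ _ (by omega) (by omega)⟩

lemma not_adj_four (hw : IsUnrolledCycle G w) (hclaw : ClawFree G) (hbull : BullFree G) {x : V}
    (hx : ∀ z, x ≠ w z) {a : ℤ} (h0 : G.Adj x (w a)) (h1 : G.Adj x (w (a + 1)))
    (h3 : G.Adj x (w (a + 3))) : False := by
  by_cases h : G.Adj x (w (a - 1))
  · exact hw.not_adj_three hclaw h (by rwa [show a - 1 + 2 = a + 1 by ring])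
      (by rwa [show a - 1 + 4 = a + 3 by ring])
  · exact hbull ⟨x, w a, w (a + 1), w (a + 3), w (a - 1), hx _,
      hw.ne _ _ (by omega) (by omega), hw.ne _ _ (by omega) (by omega),
      (hw.ne _ _ (by omega) (by omega)).symm, (hw.ne _ _ (by omega) (by omega)).symm,
      h0, hw.adj _ _ (by omega), h1.symm, h3, (hw.adj _ _ (by omega)).symm,
      hw.not_adj _ _ (by omega) (by omega), hw.not_adj _ _ (by omega) (by omega), h,
      fun h => hw.not_adj _ _ (by omega) (by omega) h.symm,
      fun h => hw.not_adj _ _ (by omega) (by omega) h.symm⟩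

lemma adj_pred_or_succ (hw : IsUnrolledCycle G w) (hclaw : ClawFree G) {x : V}
    (hx : ∀ z, x ≠ w z) {a : ℤ} (h : G.Adj x (w a)) :
    G.Adj x (w (a - 1)) ∨ G.Adj x (w (a + 1)) := by
  by_contra! hcon
  exact hclaw ⟨w a, x, w (a - 1), w (a + 1), hx _, hx _, hw.ne _ _ (by omega) (by omega),
    h.symm, (hw.adj _ _ (by omega)).symm, hw.adj _ _ (by omega), hcon.1, hcon.2,
    hw.not_adj _ _ (by omega) (by omega)⟩

lemma adj_pred_or_succ_of_edge (hw : IsUnrolledCycle G w) (hbull : BullFree G) {x : V}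
    (hx : ∀ z, x ≠ w z) {a b : ℤ} (hab : b = a + 1) (ha : G.Adj x (w a)) (hb : G.Adj x (w b)) :
    G.Adj x (w (a - 1)) ∨ G.Adj x (w (b + 1)) := by
  by_contra! hcon
  exact hbull ⟨w a, w b, x, w (a - 1), w (b + 1), hw.ne _ _ (by omega) (by omega),
    (hw.ne _ _ (by omega) (by omega)).symm, hx _, hx _, hw.ne _ _ (by omega) (by omega),
    hw.adj _ _ hab, hb.symm, ha, (hw.adj _ _ (by omega)).symm, hw.adj _ _ rfl,
    fun h => hw.not_adj _ _ (by omega) (by omega) h.symm, hcon.1,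
    hw.not_adj _ _ (by omega) (by omega), hcon.2, hw.not_adj _ _ (by omega) (by omega)⟩

/-- A vertex off the cycle with a neighbour on it is adjacent to three consecutive vertices. -/
lemma exists_center (hw : IsUnrolledCycle G w) (hclaw : ClawFree G) (hbull : BullFree G) {x : V}
    (hx : ∀ z, x ≠ w z) {i : ℤ} (hi : G.Adj x (w i)) :
    ∃ p : ℤ, i - 1 ≤ p ∧ p ≤ i + 1 ∧ ∀ z, p - 1 ≤ z → z ≤ p + 1 → G.Adj x (w z) := by
  have key : ∀ p, G.Adj x (w (p - 1)) → G.Adj x (w p) → G.Adj x (w (p + 1)) →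
      ∀ z, p - 1 ≤ z → z ≤ p + 1 → G.Adj x (w z) := by
    intro p h1 h2 h3 z hz1 hz2
    obtain rfl | rfl | rfl : z = p - 1 ∨ z = p ∨ z = p + 1 := by omega
    all_goals assumption
  rcases hw.adj_pred_or_succ hclaw hx hi with h | h
  · rcases hw.adj_pred_or_succ_of_edge hbull hx (by omega) h hi with h' | h'
    · exact ⟨i - 1, by omega, by omega, key _ h' h (by rwa [sub_add_cancel])⟩
    · exact ⟨i, by omega, by omega, key _ h hi h'⟩
  · rcases hw.adj_pred_or_succ_of_edge hbull hx rfl hi h with h' | h'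
    · exact ⟨i, by omega, by omega, key _ h' hi h⟩
    · exact ⟨i + 1, by omega, by omega, key _ (by rwa [add_sub_cancel_right]) h h'⟩

/-- A vertex adjacent to three consecutive vertices of the cycle has no other neighbours on it. -/
lemma eq_of_adj_center (hw : IsUnrolledCycle G w) (hclaw : ClawFree G) (hbull : BullFree G) {x : V}
    (hx : ∀ z, x ≠ w z) {p : ℤ} (hp : ∀ z, p - 1 ≤ z → z ≤ p + 1 → G.Adj x (w z))
    {j : ℤ} (hj : G.Adj x (w j)) : ∃ z, p - 1 ≤ z ∧ z ≤ p + 1 ∧ w j = w z := by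
  have hr : ¬ G.Adj x (w (p + 2)) := fun h =>
    hw.not_adj_four hclaw hbull hx (hp (p - 1) (by omega) (by omega))
      (hp _ (by omega) (by omega)) (by rwa [show p - 1 + 3 = p + 2 by ring])
  have hl : ¬ G.Adj x (w (p - 2)) := fun h =>
    hw.neg.not_adj_four hclaw hbull (fun z => hx (-z)) (a := -p - 1)
      (hp _ (by omega) (by omega)) (hp _ (by omega) (by omega))
      (by rwa [show -(-p - 1 + 3) = p - 2 by ring])
  by_contra! hcon
  refine hclaw ⟨x, w (p - 1), w (p + 1), w j, hw.ne _ _ (by omega) (by omega),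
    (hcon _ (by omega) (by omega)).symm, (hcon _ (by omega) (by omega)).symm,
    hp _ (by omega) (by omega), hp _ (by omega) (by omega), hj,
    hw.not_adj _ _ (by omega) (by omega), fun h => ?_, fun h => ?_⟩
  · rcases hw.eq_of_adj _ _ h with h | h
    · exact hcon _ (by omega) (by omega) h
    · rw [h, show p - 1 - 1 = p - 2 by ring] at hj
      exact hl hj
  · rcases hw.eq_of_adj _ _ h with h | h
    · rw [h, show p + 1 + 1 = p + 2 by ring] at hj
      exact hr hj
    · exact hcon _ (by omega) (by omega) h

/-- The neighbours on the cycle of any vertex lie within three consecutive vertices; either the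
vertex is the middle one, or it is off the cycle and adjacent to all three. -/
lemma exists_window (hw : IsUnrolledCycle G w) (hclaw : ClawFree G) (hbull : BullFree G)
    {x : V} {i : ℤ} (hi : G.Adj x (w i)) :
    ∃ p : ℤ, i - 1 ≤ p ∧ p ≤ i + 1 ∧
      (∀ j, G.Adj x (w j) → ∃ z, p - 1 ≤ z ∧ z ≤ p + 1 ∧ w j = w z) ∧
      (x = w p ∨ (∀ z, x ≠ w z) ∧ ∀ z, p - 1 ≤ z → z ≤ p + 1 → G.Adj x (w z)) := by
  by_cases hx : ∃ p, x = w p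
  · obtain ⟨p, hp, hpi⟩ : ∃ p : ℤ, x = w p ∧ (p = i + 1 ∨ p = i - 1) := by
      obtain ⟨a, rfl⟩ := hx
      rcases hw.eq_of_adj _ _ hi.symm with h | h
      · exact ⟨_, h, .inl rfl⟩
      · exact ⟨_, h, .inr rfl⟩
    refine ⟨p, by omega, by omega, fun j hj => ?_, .inl hp⟩
    subst hp
    rcases hw.eq_of_adj _ _ hj with h | h
    · exact ⟨_, by omega, by omega, h⟩
    · exact ⟨_, by omega, by omega, h⟩
  · push Not at hx
    obtain ⟨p, h1, h2, hp⟩ := hw.exists_center hclaw hbull hx hi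
    exact ⟨p, h1, h2, fun j hj => hw.eq_of_adj_center hclaw hbull hx hp hj, .inr ⟨hx, hp⟩⟩

lemma eq_of_eq (hw : IsUnrolledCycle G w) {a b : ℤ} (h : w a = w b) (h1 : a - b ≤ 5)
    (h2 : b - a ≤ 5) : a = b := by
  by_contra hab
  rcases lt_or_gt_of_ne hab with hlt | hlt
  · exact hw.ne a b (by omega) h2 h
  · exact hw.ne b a (by omega) h1 h.symm

/-- Off-cycle vertices attached to the same three consecutive vertices are adjacent. -/
lemma adj_of_same_center (hw : IsUnrolledCycle G w) (hclaw : ClawFree G) (hbull : BullFree G)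
    {x y : V} (hxy : x ≠ y) {p : ℤ}
    (hx : ∀ z, x ≠ w z) (hpx : ∀ z, p - 1 ≤ z → z ≤ p + 1 → G.Adj x (w z))
    (hy : ∀ z, y ≠ w z) (hpy : ∀ z, p - 1 ≤ z → z ≤ p + 1 → G.Adj y (w z)) : G.Adj x y := by
  have hfar : ∀ {u : V}, (∀ z, u ≠ w z) → (∀ z, p - 1 ≤ z → z ≤ p + 1 → G.Adj u (w z)) →
      ¬ G.Adj u (w (p + 2)) := fun hu hpu h =>
    hw.not_adj_four hclaw hbull hu (hpu (p - 1) (by omega) (by omega))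
      (hpu _ (by omega) (by omega)) (by rwa [show p - 1 + 3 = p + 2 by ring])
  by_contra hcon
  exact hclaw ⟨w (p + 1), x, y, w (p + 2), hxy, hx _, hy _,
    (hpx _ (by omega) (by omega)).symm, (hpy _ (by omega) (by omega)).symm,
    hw.adj _ _ (by omega), hcon, hfar hx hpx, hfar hy hpy⟩

/-- Off-cycle vertices attached to consecutive windows of the cycle are adjacent. -/
lemma adj_of_succ_center (hw : IsUnrolledCycle G w) (hclaw : ClawFree G) (hbull : BullFree G)
    {x y : V} {p q : ℤ} (hq : q = p + 1)
    (hx : ∀ z, x ≠ w z) (hpx : ∀ z, p - 1 ≤ z → z ≤ p + 1 → G.Adj x (w z))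
    (hy : ∀ z, y ≠ w z) (hqy : ∀ z, q - 1 ≤ z → z ≤ q + 1 → G.Adj y (w z)) : G.Adj x y := by
  have hfar : ∀ {u : V}, (∀ z, u ≠ w z) → ∀ {c : ℤ},
      (∀ z, c - 1 ≤ z → z ≤ c + 1 → G.Adj u (w z)) → ∀ z, c + 2 ≤ z → z ≤ c + 3 →
      ¬ G.Adj u (w z) := by
    intro u hu c hc z hz1 hz2 h
    obtain ⟨z', h1, h2, h3⟩ := hw.eq_of_adj_center hclaw hbull hu hc h
    have := hw.eq_of_eq h3 (by omega) (by omega)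
    omega
  by_contra hcon
  exact hbull ⟨w (p + 1), w (p + 2), y, x, w (p + 3), hw.ne _ _ (by omega) (by omega),
    (hx _).symm, fun h => hfar hx hpx (p + 2) (by omega) (by omega)
      (h ▸ hqy _ (by omega) (by omega)), hy _, hx _,
    hw.adj _ _ (by omega), (hqy _ (by omega) (by omega)).symm, hqy _ (by omega) (by omega),
    (hpx _ (by omega) (by omega)).symm, hw.adj _ _ (by omega),
    fun h => hfar hx hpx _ (by omega) (by omega) h.symm, fun h => hcon h.symm,
    hw.not_adj _ _ (by omega) (by omega), hfar hy hqy _ (by omega) (by omega),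
    hfar hx hpx _ (by omega) (by omega)⟩

end IsUnrolledCycle

/-- In a connected (claw, bull)-free graph with an induced cycle of length `k ≥ 6`,
two distinct vertices having at least two common neighbors on the cycle are adjacent. -/
theorem adj_of_two_common_cycle_neighbors {V : Type*} [Fintype V] (G : SimpleGraph V)
    (hconn : G.Connected) (hclaw : ClawFree G) (hbull : BullFree G)
    (k : ℕ) (hk : 6 ≤ k) (v : ZMod k → V) (hC : IsInducedCycle G k v)
    (x y : V) (hxy : x ≠ y)
    (hcommon : ∃ i j : ZMod k, i ≠ j ∧
      G.Adj x (v i) ∧ G.Adj y (v i) ∧ G.Adj x (v j) ∧ G.Adj y (v j)) :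
    G.Adj x y := by
  have hw := hC.isUnrolledCycle hk
  obtain ⟨i', j', hij', hxi, hyi, hxj, hyj⟩ := hcommon
  obtain ⟨i, rfl⟩ := ZMod.intCast_surjective i'
  obtain ⟨j, rfl⟩ := ZMod.intCast_surjective j'
  have hij : v (i : ZMod k) ≠ v (j : ZMod k) := hC.1.ne hij'
  set w : ℤ → V := fun z => v (z : ZMod k)
  change w i ≠ w j at hij
  obtain ⟨p, hp1, hp2, hpw, hp⟩ := hw.exists_window hclaw hbull (i := i) hxi
  obtain ⟨q, hq1, hq2, hqw, hq⟩ := hw.exists_window hclaw hbull (i := i) hyi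
  obtain ⟨a, ha1, ha2, ha⟩ := hpw j hxj
  obtain ⟨b, hb1, hb2, hb⟩ := hqw j hyj
  have hab : a = b := hw.eq_of_eq (ha.symm.trans hb) (by omega) (by omega)
  have hia : i ≠ a := by
    rintro rfl
    exact hij ha.symm
  have hpq : q = p ∨ q = p + 1 ∨ p = q + 1 := by omega
  rcases hp with rfl | ⟨hx, hpx⟩ <;> rcases hq with rfl | ⟨hy, hqy⟩
  · rcases hpq with rfl | h | h
    · exact absurd rfl hxy
    · exact hw.adj _ _ h
    · exact (hw.adj _ _ h).symm
  · exact (hqy p (by omega) (by omega)).symm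
  · exact hpx q (by omega) (by omega)
  · rcases hpq with rfl | h | h
    · exact hw.adj_of_same_center hclaw hbull hxy hx hpx hy hqy
    · exact hw.adj_of_succ_center hclaw hbull h hx hpx hy hqy
    · exact (hw.adj_of_succ_center hclaw hbull h hy hqy hx hpx).symm
end

section
/- Let G be a finite connected graph that is claw-free and bull-free. If G contains an induced cycle of length 4 and contains no induced cycle of length at least 5, then the independence number of G is at most 2, i.e., among any three distinct vertices of G some two are adjacent. -/
namespace SimpleGraph

variable {V : Type*} {G : SimpleGraph V}

/-- `a b c d` is an induced 4-cycle, in this cyclic order. -/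
structure IsInducedSquare (G : SimpleGraph V) (a b c d : V) : Prop where
  adj_ab : G.Adj a b
  adj_bc : G.Adj b c
  adj_cd : G.Adj c d
  adj_da : G.Adj d a
  ne_ac : a ≠ c
  ne_bd : b ≠ d
  not_adj_ac : ¬ G.Adj a c
  not_adj_bd : ¬ G.Adj b d

/-- Equality or adjacency: membership in the closed neighbourhood. -/
def ClosedAdj (G : SimpleGraph V) (x y : V) : Prop := x = y ∨ G.Adj x y

theorem _root_.ClawFree.adj (h : ClawFree G) {v a b c : V} (hva : G.Adj v a) (hvb : G.Adj v b)
    (hvc : G.Adj v c) : G.ClosedAdj a b ∨ G.ClosedAdj a c ∨ G.ClosedAdj b c := by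
  by_contra hn
  simp only [ClosedAdj, not_or] at hn
  exact h ⟨v, a, b, c, hn.1.1, hn.2.1.1, hn.2.2.1, hva, hvb, hvc, hn.1.2, hn.2.1.2, hn.2.2.2⟩

theorem _root_.BullFree.adj (h : BullFree G) {a b c d e : V} (hab : G.Adj a b) (hbc : G.Adj b c)
    (hca : G.Adj c a) (had : G.Adj a d) (hbe : G.Adj b e) :
    G.ClosedAdj b d ∨ G.ClosedAdj c d ∨ G.ClosedAdj a e ∨ G.ClosedAdj c e ∨
      G.ClosedAdj d e := by
  by_contra hn
  simp only [ClosedAdj, not_or] at hn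
  obtain ⟨⟨h1, h2⟩, ⟨h3, h4⟩, ⟨h5, h6⟩, ⟨h7, h8⟩, h9, h10⟩ := hn
  exact h ⟨a, b, c, d, e, h5, h1, h3, h7, h9, hab, hbc, hca, had, hbe, h2, h4, h6, h8, h10⟩

theorem _root_.IsInducedCycle.isInducedSquare {v : ZMod 4 → V} (h : IsInducedCycle G 4 v) :
    G.IsInducedSquare (v 0) (v 1) (v 2) (v 3) where
  adj_ab := (h.2 _ _).2 (by decide)
  adj_bc := (h.2 _ _).2 (by decide)
  adj_cd := (h.2 _ _).2 (by decide)
  adj_da := (h.2 _ _).2 (by decide)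
  ne_ac := h.1.ne (by decide)
  ne_bd := h.1.ne (by decide)
  not_adj_ac := fun hn => absurd ((h.2 _ _).1 hn) (by decide)
  not_adj_bd := fun hn => absurd ((h.2 _ _).1 hn) (by decide)

namespace IsInducedSquare

variable {a b c d x y z : V}

theorem rotate (h : G.IsInducedSquare a b c d) : G.IsInducedSquare b c d a :=
  ⟨h.adj_bc, h.adj_cd, h.adj_da, h.adj_ab, h.ne_bd, h.ne_ac.symm, h.not_adj_bd,
    fun hn => h.not_adj_ac hn.symm⟩

theorem reflect (h : G.IsInducedSquare a b c d) : G.IsInducedSquare b a d c :=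
  ⟨h.adj_ab.symm, h.adj_da.symm, h.adj_cd.symm, h.adj_bc.symm, h.ne_bd, h.ne_ac, h.not_adj_bd,
    h.not_adj_ac⟩

/-- A vertex close to one vertex of the square is close to a neighbour of it on the square. -/
theorem closedAdj_of_closedAdj (h : G.IsInducedSquare a b c d) (hclaw : ClawFree G)
    (hx : G.ClosedAdj x a) : G.ClosedAdj x b ∨ G.ClosedAdj x d := by
  have := h.adj_ab
  have := h.adj_da.symm
  obtain rfl | hx := hx
  · exact .inl (.inr h.adj_ab)
  have := h.ne_bd
  have := h.not_adj_bd
  have := hclaw.adj h.adj_ab h.adj_da.symm hx.symm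
  grind [ClosedAdj, G.adj_comm]

/-- A neighbour of a vertex close to both ends of an edge of the square is close to the square. -/
theorem exists_closedAdj_of_adj (h : G.IsInducedSquare a b c d) (hclaw : ClawFree G)
    (hbull : BullFree G) (hxa : G.ClosedAdj x a) (hxb : G.ClosedAdj x b) (hxy : G.Adj x y) :
    G.ClosedAdj y a ∨ G.ClosedAdj y b ∨ G.ClosedAdj y c ∨ G.ClosedAdj y d := by
  obtain ⟨h1, h2, h3, h4, h5, h6, h7, h8⟩ := h
  obtain rfl | hxa := hxa
  · exact .inl (.inr hxy.symm)
  obtain rfl | hxb := hxb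
  · exact .inr (.inl (.inr hxy.symm))
  by_contra hn
  by_cases hc : G.Adj x c
  · have := hclaw.adj hxa hc hxy
    grind [ClosedAdj, G.adj_comm]
  by_cases hd : G.Adj x d
  · have := hclaw.adj hxb hd hxy
    grind [ClosedAdj, G.adj_comm]
  have := hbull.adj hxa h1 hxb.symm hxy h4.symm
  grind [ClosedAdj, G.adj_comm]

/-- The square dominates the graph. -/
theorem exists_closedAdj (h : G.IsInducedSquare a b c d) (hconn : G.Connected)
    (hclaw : ClawFree G) (hbull : BullFree G) (x : V) :
    G.ClosedAdj x a ∨ G.ClosedAdj x b ∨ G.ClosedAdj x c ∨ G.ClosedAdj x d := by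
  obtain ⟨p⟩ := hconn.preconnected x a
  induction p with
  | nil => exact .inl (.inl rfl)
  | @cons u w _ hadj p ih =>
    have e1 := fun h1 h2 => h.exists_closedAdj_of_adj hclaw hbull (x := w) h1 h2 hadj.symm
    have e2 := fun h1 h2 => h.rotate.exists_closedAdj_of_adj hclaw hbull (x := w) h1 h2 hadj.symm
    have e3 := fun h1 h2 =>
      h.rotate.rotate.exists_closedAdj_of_adj hclaw hbull (x := w) h1 h2 hadj.symm
    have e4 := fun h1 h2 =>
      h.rotate.rotate.rotate.exists_closedAdj_of_adj hclaw hbull (x := w) h1 h2 hadj.symm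
    have f1 := h.closedAdj_of_closedAdj hclaw (x := w)
    have f2 := h.rotate.closedAdj_of_closedAdj hclaw (x := w)
    have f3 := h.rotate.rotate.closedAdj_of_closedAdj hclaw (x := w)
    have f4 := h.rotate.rotate.rotate.closedAdj_of_closedAdj hclaw (x := w)
    have := ih h
    grind

/-- Every vertex is close to both ends of some edge of the square. -/
theorem exists_edge (h : G.IsInducedSquare a b c d) (hconn : G.Connected)
    (hclaw : ClawFree G) (hbull : BullFree G) (x : V) :
    (G.ClosedAdj x a ∧ G.ClosedAdj x b) ∨ (G.ClosedAdj x b ∧ G.ClosedAdj x c) ∨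
      (G.ClosedAdj x c ∧ G.ClosedAdj x d) ∨ (G.ClosedAdj x d ∧ G.ClosedAdj x a) := by
  have e1 := h.closedAdj_of_closedAdj hclaw (x := x)
  have e2 := h.rotate.closedAdj_of_closedAdj hclaw (x := x)
  have e3 := h.rotate.rotate.closedAdj_of_closedAdj hclaw (x := x)
  have e4 := h.rotate.rotate.rotate.closedAdj_of_closedAdj hclaw (x := x)
  have := h.exists_closedAdj hconn hclaw hbull x
  grind

/-- No vertex is close to three independent vertices. -/
theorem _root_.ClawFree.not_closedAdj (hclaw : ClawFree G) (hxy : ¬ G.ClosedAdj x y)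
    (hxz : ¬ G.ClosedAdj x z) (hyz : ¬ G.ClosedAdj y z) (hx : G.ClosedAdj x a)
    (hy : G.ClosedAdj y a) : ¬ G.ClosedAdj z a := by
  intro hz
  have := hclaw.adj (v := a) (a := x) (b := y) (c := z)
  grind [ClosedAdj, G.adj_comm]

/-- If `x` is attached exactly to the edge `ab`, its non-neighbours close to `a` are close
to `d`. -/
theorem closedAdj_of_not_closedAdj (h : G.IsInducedSquare a b c d) (hclaw : ClawFree G)
    (hxa : G.ClosedAdj x a) (hxd : ¬ G.ClosedAdj x d)
    (hxy : ¬ G.ClosedAdj x y) (hy : G.ClosedAdj y a) : G.ClosedAdj y d := by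
  obtain ⟨h1, h2, h3, h4, h5, h6, h7, h8⟩ := h
  have := hclaw.adj (v := a) (a := x) (b := y) (c := d)
  grind [ClosedAdj, G.adj_comm]

/-- A non-neighbour of a vertex attached exactly to the edge `ab` is close to both `c`
and `d`. -/
theorem closedAdj_opposite (h : G.IsInducedSquare a b c d) (hconn : G.Connected)
    (hclaw : ClawFree G) (hbull : BullFree G) (hxa : G.ClosedAdj x a) (hxb : G.ClosedAdj x b)
    (hxc : ¬ G.ClosedAdj x c) (hxd : ¬ G.ClosedAdj x d) (hxy : ¬ G.ClosedAdj x y) :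
    G.ClosedAdj y c ∧ G.ClosedAdj y d := by
  have e := h.exists_edge hconn hclaw hbull y
  have f1 := h.closedAdj_of_not_closedAdj hclaw hxa hxd hxy
  have f2 := h.reflect.closedAdj_of_not_closedAdj hclaw hxb hxc hxy
  obtain ⟨h1, h2, h3, h4, h5, h6, h7, h8⟩ := h
  have b1 := hbull.adj (a := a) (b := b) (c := x) (d := d) (e := y)
  have b2 := hbull.adj (a := b) (b := a) (c := x) (d := c) (e := y)
  have hxa' : G.Adj x a := by grind [ClosedAdj, G.adj_comm]
  have hxb' : G.Adj x b := by grind [ClosedAdj, G.adj_comm]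
  grind [ClosedAdj, G.adj_comm]

/-- If `x` is attached exactly to the edge `ab`, then `a` is not close to either of two
nonadjacent non-neighbours of `x`. -/
theorem not_closedAdj_of_edge (h : G.IsInducedSquare a b c d) (hclaw : ClawFree G)
    (hbull : BullFree G) (hxa : G.ClosedAdj x a) (hxd : ¬ G.ClosedAdj x d)
    (hyd : G.ClosedAdj y d) (hzd : G.ClosedAdj z d) (hxy : ¬ G.ClosedAdj x y)
    (hxz : ¬ G.ClosedAdj x z) (hyz : ¬ G.ClosedAdj y z) : ¬ G.ClosedAdj y a := by
  intro hy
  have hza := hclaw.not_closedAdj hxy hxz hyz hxa hy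
  have := h.adj_da
  have := hbull.adj (a := a) (b := d) (c := y) (d := x) (e := z)
  grind [ClosedAdj, G.adj_comm]

/-- A vertex attached exactly to an edge of the square lies in no independent triple. -/
theorem closedAdj_of_edge (h : G.IsInducedSquare a b c d) (hconn : G.Connected)
    (hclaw : ClawFree G) (hbull : BullFree G) (hxa : G.ClosedAdj x a) (hxb : G.ClosedAdj x b)
    (hxc : ¬ G.ClosedAdj x c) (hxd : ¬ G.ClosedAdj x d) (hxy : ¬ G.ClosedAdj x y)
    (hxz : ¬ G.ClosedAdj x z) : G.ClosedAdj y z := by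
  by_contra hyz
  have hzy : ¬ G.ClosedAdj z y := fun hn => hyz (hn.imp Eq.symm Adj.symm)
  obtain ⟨hyc, hyd⟩ := h.closedAdj_opposite hconn hclaw hbull hxa hxb hxc hxd hxy
  obtain ⟨hzc, hzd⟩ := h.closedAdj_opposite hconn hclaw hbull hxa hxb hxc hxd hxz
  have hya := h.not_closedAdj_of_edge hclaw hbull hxa hxd hyd hzd hxy hxz hyz
  have hyb := h.reflect.not_closedAdj_of_edge hclaw hbull hxb hxc hyc hzc hxy hxz hyz
  have hza := h.not_closedAdj_of_edge hclaw hbull hxa hxd hzd hyd hxz hxy hzy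
  exact hza (h.rotate.rotate.closedAdj_opposite hconn hclaw hbull hyc hyd hya hyb hyz).1

/-- A vertex of an independent triple is close to three vertices of the square. -/
theorem closedAdj_three (h : G.IsInducedSquare a b c d) (hconn : G.Connected)
    (hclaw : ClawFree G) (hbull : BullFree G) (hxy : ¬ G.ClosedAdj x y)
    (hxz : ¬ G.ClosedAdj x z) (hyz : ¬ G.ClosedAdj y z) :
    (G.ClosedAdj x a ∧ G.ClosedAdj x c ∧ (G.ClosedAdj x b ∨ G.ClosedAdj x d)) ∨
      (G.ClosedAdj x b ∧ G.ClosedAdj x d ∧ (G.ClosedAdj x a ∨ G.ClosedAdj x c)) := by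
  have e := h.exists_edge hconn hclaw hbull x
  have e1 := fun h1 h2 h3 h4 => hyz <|
    h.closedAdj_of_edge hconn hclaw hbull h1 h2 h3 h4 hxy hxz
  have e2 := fun h1 h2 h3 h4 => hyz <|
    h.rotate.closedAdj_of_edge hconn hclaw hbull h1 h2 h3 h4 hxy hxz
  have e3 := fun h1 h2 h3 h4 => hyz <|
    h.rotate.rotate.closedAdj_of_edge hconn hclaw hbull h1 h2 h3 h4 hxy hxz
  have e4 := fun h1 h2 h3 h4 => hyz <|
    h.rotate.rotate.rotate.closedAdj_of_edge hconn hclaw hbull h1 h2 h3 h4 hxy hxz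
  grind

/-- A connected (claw, bull)-free graph with an induced 4-cycle has no independent triple. -/
theorem closedAdj_of_not_closedAdj_triple (h : G.IsInducedSquare a b c d) (hconn : G.Connected)
    (hclaw : ClawFree G) (hbull : BullFree G) (hxy : ¬ G.ClosedAdj x y)
    (hxz : ¬ G.ClosedAdj x z) : G.ClosedAdj y z := by
  by_contra hyz
  have symm : ∀ {u v}, ¬ G.ClosedAdj u v → ¬ G.ClosedAdj v u := fun huv hn =>
    huv (hn.imp Eq.symm Adj.symm)
  have hx := h.closedAdj_three hconn hclaw hbull hxy hxz hyz
  have hy := h.closedAdj_three hconn hclaw hbull (symm hxy) hyz hxz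
  have hz := h.closedAdj_three hconn hclaw hbull (symm hxz) (symm hyz) hxy
  have e (t : V) := hclaw.not_closedAdj (a := t) hxy hxz hyz
  have ha := e a
  have hb := e b
  have hc := e c
  have hd := e d
  clear e
  grind

end IsInducedSquare

end SimpleGraph

/-- A connected (claw, bull)-free graph with an induced 4-cycle and no induced cycle of
length at least 5 has independence number at most 2. -/
theorem indepNum_le_two_of_C4 {V : Type*} [Fintype V] (G : SimpleGraph V)
    (hconn : G.Connected) (hclaw : ClawFree G) (hbull : BullFree G)
    (hC4 : ∃ v : ZMod 4 → V, IsInducedCycle G 4 v)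
    (hno : ∀ k : ℕ, 5 ≤ k → ∀ v : ZMod k → V, ¬ IsInducedCycle G k v) :
    ∀ x y z : V, x ≠ y → x ≠ z → y ≠ z → G.Adj x y ∨ G.Adj x z ∨ G.Adj y z := by
  obtain ⟨v, hv⟩ := hC4
  intro x y z hxy hxz hyz
  by_contra hn
  have := hv.isInducedSquare.closedAdj_of_not_closedAdj_triple (x := x) (y := y) (z := z)
    hconn hclaw hbull
  grind [SimpleGraph.ClosedAdj]
end

section
/- Let G be a finite connected graph that is claw-free and bull-free. If G contains an induced cycle of length 5 and contains no induced cycle of length at least 6, then the independence number of G is at most 2, i.e., among any three distinct vertices of G some two are adjacent. -/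
/-- `a b c d e` is an induced 5-cycle of `G`; distinctness follows from the adjacencies. -/
structure IsInducedC5 {V : Type*} (G : SimpleGraph V) (a b c d e : V) : Prop where
  ab : G.Adj a b
  bc : G.Adj b c
  cd : G.Adj c d
  de : G.Adj d e
  ea : G.Adj e a
  ac : ¬ G.Adj a c
  bd : ¬ G.Adj b d
  ce : ¬ G.Adj c e
  da : ¬ G.Adj d a
  eb : ¬ G.Adj e b

section

variable {V : Type*} {G : SimpleGraph V} {a b c d e x y z : V}

theorem ClawFree.exists_adj (h : ClawFree G) {v : V} (ha : G.Adj v a) (hb : G.Adj v b)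
    (hc : G.Adj v c) (hab : a ≠ b) (hac : a ≠ c) (hbc : b ≠ c) :
    G.Adj a b ∨ G.Adj a c ∨ G.Adj b c := by
  by_contra! hn
  exact h ⟨v, a, b, c, hab, hac, hbc, ha, hb, hc, hn.1, hn.2.1, hn.2.2⟩

namespace IsInducedC5

theorem rotate (h : IsInducedC5 G a b c d e) : IsInducedC5 G b c d e a :=
  ⟨h.bc, h.cd, h.de, h.ea, h.ab, h.bd, h.ce, h.da, h.eb, h.ac⟩

theorem reflect (h : IsInducedC5 G a b c d e) : IsInducedC5 G a e d c b :=
  ⟨h.ea.symm, h.de.symm, h.cd.symm, h.bc.symm, h.ab.symm, fun k => h.da k.symm,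
    fun k => h.ce k.symm, fun k => h.bd k.symm, fun k => h.ac k.symm, fun k => h.eb k.symm⟩

theorem ne_two (h : IsInducedC5 G a b c d e) : a ≠ c := by
  rintro rfl
  exact h.da h.cd.symm

theorem adj_or_adj_of_adj_edge (h : IsInducedC5 G a b c d e) (hbull : BullFree G)
    (hxc : x ≠ c) (hxe : x ≠ e) (hxa : G.Adj x a) (hxb : G.Adj x b) :
    G.Adj x c ∨ G.Adj x e := by
  by_contra! hn
  exact hbull ⟨a, b, x, e, c, h.ne_two, h.rotate.rotate.rotate.rotate.ne_two.symm, hxe, hxc,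
    h.rotate.rotate.ne_two.symm, h.ab, hxb.symm, hxa, h.ea.symm, h.bc, fun k => h.eb k.symm,
    hn.2, h.ac, hn.1, fun k => h.ce k.symm⟩

/-- A vertex off an induced 5-cycle adjacent to one of its vertices is adjacent to three
consecutive ones. -/
theorem adj_three_of_adj (h : IsInducedC5 G a b c d e) (hclaw : ClawFree G)
    (hbull : BullFree G) (hxb : x ≠ b) (hxc : x ≠ c) (hxd : x ≠ d) (hxe : x ≠ e)
    (hxa : G.Adj x a) :
    (G.Adj x e ∧ G.Adj x b) ∨ (G.Adj x b ∧ G.Adj x c) ∨ (G.Adj x d ∧ G.Adj x e) := by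
  have hbe := h.rotate.rotate.rotate.rotate.ne_two.symm
  rcases hclaw.exists_adj hxa.symm h.ab h.ea.symm hxb hxe hbe with k | k | k
  · have := h.adj_or_adj_of_adj_edge hbull hxc hxe hxa k
    tauto
  · have := h.reflect.adj_or_adj_of_adj_edge hbull hxd hxb hxa k
    tauto
  · exact absurd k.symm h.eb

/-- `x` equals or is adjacent to each of `p q r`. -/
def NearAll (G : SimpleGraph V) (p q r x : V) : Prop :=
  (x = p ∨ G.Adj x p) ∧ (x = q ∨ G.Adj x q) ∧ (x = r ∨ G.Adj x r)

/-- The closed neighbourhood of `x` contains three consecutive vertices of the cycle. -/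
def Near (G : SimpleGraph V) (a b c d e x : V) : Prop :=
  NearAll G a b c x ∨ NearAll G b c d x ∨ NearAll G c d e x ∨ NearAll G d e a x ∨
    NearAll G e a b x

theorem Near.rotate (hx : Near G b c d e a x) : Near G a b c d e x := by
  rcases hx with k | k | k | k | k <;> simp [Near, k]

theorem near_of_eq_or_adj (h : IsInducedC5 G a b c d e) (hclaw : ClawFree G)
    (hbull : BullFree G) (hx : x = a ∨ G.Adj x a) : Near G a b c d e x := by
  have key (hp : x = e ∨ G.Adj x e) (hr : x = b ∨ G.Adj x b) : Near G a b c d e x :=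
    .inr (.inr (.inr (.inr ⟨hp, hx, hr⟩)))
  rcases hx with rfl | hxa
  · exact key (.inr h.ea.symm) (.inr h.ab)
  by_cases hxb : x = b
  · subst hxb
    exact .inl ⟨.inr hxa, .inl rfl, .inr h.bc⟩
  by_cases hxc : x = c
  · exact absurd (hxc ▸ hxa.symm) h.ac
  by_cases hxd : x = d
  · exact absurd (hxd ▸ hxa) h.da
  by_cases hxe : x = e
  · subst hxe
    exact .inr (.inr (.inr (.inl ⟨.inr h.de.symm, .inl rfl, .inr hxa⟩)))
  rcases h.adj_three_of_adj hclaw hbull hxb hxc hxd hxe hxa with k | k | k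
  · exact key (.inr k.1) (.inr k.2)
  · exact .inl ⟨.inr hxa, .inr k.1, .inr k.2⟩
  · exact .inr (.inr (.inr (.inl ⟨.inr k.1, .inr k.2, .inr hxa⟩)))

theorem near_of_mem_or_adj (h : IsInducedC5 G a b c d e) (hclaw : ClawFree G)
    (hbull : BullFree G)
    (hx : (x = a ∨ G.Adj x a) ∨ (x = b ∨ G.Adj x b) ∨ (x = c ∨ G.Adj x c) ∨
      (x = d ∨ G.Adj x d) ∨ (x = e ∨ G.Adj x e)) : Near G a b c d e x := by
  rcases hx with k | k | k | k | k
  · exact h.near_of_eq_or_adj hclaw hbull k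
  · exact (h.rotate.near_of_eq_or_adj hclaw hbull k).rotate
  · exact (h.rotate.rotate.near_of_eq_or_adj hclaw hbull k).rotate.rotate
  · exact (h.rotate.rotate.rotate.near_of_eq_or_adj hclaw hbull k).rotate.rotate.rotate
  · exact
      (h.rotate.rotate.rotate.rotate.near_of_eq_or_adj hclaw hbull k).rotate.rotate.rotate.rotate

theorem eq_or_adj_of_adj (h : IsInducedC5 G a b c d e) (hclaw : ClawFree G)
    (hxy : G.Adj x y) (ha : x = a ∨ G.Adj x a)
    (hc : x = c ∨ G.Adj x c) :
    (y = a ∨ G.Adj y a) ∨ (y = c ∨ G.Adj y c) := by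
  by_contra! hn
  obtain ⟨⟨ya, nya⟩, ⟨yc, nyc⟩⟩ := hn
  have hxa : G.Adj x a := ha.resolve_left (by rintro rfl; exact nya hxy.symm)
  have hxc : G.Adj x c := hc.resolve_left (by rintro rfl; exact nyc hxy.symm)
  rcases hclaw.exists_adj hxy hxa hxc ya yc h.ne_two with k | k | k
  exacts [nya k, nyc k, h.ac k]

theorem near_of_adj (h : IsInducedC5 G a b c d e) (hclaw : ClawFree G) (hbull : BullFree G)
    (hxy : G.Adj x y) (hx : Near G a b c d e x) : Near G a b c d e y := by
  apply h.near_of_mem_or_adj hclaw hbull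
  rcases hx with ⟨hp, _, hr⟩ | ⟨hp, _, hr⟩ | ⟨hp, _, hr⟩ | ⟨hp, _, hr⟩ |
    ⟨hp, _, hr⟩
  · have := h.eq_or_adj_of_adj hclaw hxy hp hr
    tauto
  · have := h.rotate.eq_or_adj_of_adj hclaw hxy hp hr
    tauto
  · have := h.rotate.rotate.eq_or_adj_of_adj hclaw hxy hp hr
    tauto
  · have := h.rotate.rotate.rotate.eq_or_adj_of_adj hclaw hxy hp hr
    tauto
  · have := h.rotate.rotate.rotate.rotate.eq_or_adj_of_adj hclaw hxy hp hr
    tauto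

theorem near (h : IsInducedC5 G a b c d e) (hclaw : ClawFree G) (hbull : BullFree G)
    (hconn : G.Connected) (x : V) : Near G a b c d e x := by
  obtain ⟨w⟩ := hconn.preconnected x a
  induction w with
  | nil => exact h.near_of_eq_or_adj hclaw hbull (.inl rfl)
  | cons hadj _ ih => exact h.near_of_adj hclaw hbull hadj.symm (ih h)

/-- The bull that arises when the two non-neighbours of `a` are attached to different sides. -/
theorem adj_of_near_sides (h : IsInducedC5 G a b c d e) (hbull : BullFree G)
    (hya : ¬ G.Adj y a) (hza : ¬ G.Adj z a) (hyz : y ≠ z)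
    (hyb : G.Adj y b) (hyc : y = c ∨ G.Adj y c) (hzb : ¬ G.Adj z b) (hz : z ≠ a)
    (hy : y ≠ a) (hzc : z = c ∨ G.Adj z c) : G.Adj y z := by
  by_contra hn
  have hyc' : G.Adj y c := hyc.resolve_left (by
    rintro rfl
    exact hzc.elim (fun k => hyz k.symm) (fun k => hn k.symm))
  have hzc' : G.Adj z c := hzc.resolve_left (by rintro rfl; exact hn hyc')
  exact hbull ⟨b, c, y, a, z, by rintro rfl; exact hn hyb, h.ne_two.symm, hy, hyz, hz.symm,
    h.bc, hyc'.symm, hyb, h.ab.symm, hzc'.symm, fun k => h.ac k.symm, hya,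
    fun k => hzb k.symm, hn, fun k => hza k.symm⟩

theorem near_side (h : IsInducedC5 G a b c d e) (hx : Near G a b c d e x) (hxa : x ≠ a)
    (nxa : ¬ G.Adj x a) :
    (x = c ∨ G.Adj x c) ∧ (x = d ∨ G.Adj x d) ∧ (G.Adj x b ∨ G.Adj x e) := by
  have hb : x ≠ b := by rintro rfl; exact nxa h.ab.symm
  have he : x ≠ e := by rintro rfl; exact nxa h.ea
  rcases hx with ⟨hp, hq, hr⟩ | ⟨hp, hq, hr⟩ | ⟨hp, hq, hr⟩ | ⟨hp, hq, hr⟩ |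
    ⟨hp, hq, hr⟩ <;> tauto

/-- The non-neighbours of a vertex of an induced 5-cycle form a clique. -/
theorem adj_of_not_adj (h : IsInducedC5 G a b c d e) (hclaw : ClawFree G) (hbull : BullFree G)
    (hconn : G.Connected) (hya : y ≠ a) (nya : ¬ G.Adj y a) (hza : z ≠ a) (nza : ¬ G.Adj z a)
    (hyz : y ≠ z) : G.Adj y z := by
  obtain ⟨yc, yd, yside⟩ := h.near_side (h.near hclaw hbull hconn y) hya nya
  obtain ⟨zc, zd, zside⟩ := h.near_side (h.near hclaw hbull hconn z) hza nza
  by_cases hyb : G.Adj y b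
  · by_cases hzb : G.Adj z b
    · rcases hclaw.exists_adj hyb.symm hzb.symm h.ab.symm hyz hya hza with k | k | k
      exacts [k, absurd k nya, absurd k nza]
    · exact h.adj_of_near_sides hbull nya nza hyz hyb yc hzb hza hya zc
  · by_cases hze : G.Adj z e
    · have hye : G.Adj y e := yside.resolve_left hyb
      rcases hclaw.exists_adj hye.symm hze.symm h.ea hyz hya hza with k | k | k
      exacts [k, absurd k nya, absurd k nza]
    · have hye : G.Adj y e := yside.resolve_left hyb
      exact h.reflect.adj_of_near_sides hbull nya nza hyz hye yd hze hza hya zd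

theorem replace (h : IsInducedC5 G a b c d e) (hxe : G.Adj x e) (hxb : G.Adj x b)
    (hxc : ¬ G.Adj x c) (hxd : ¬ G.Adj x d) : IsInducedC5 G x b c d e :=
  ⟨hxb, h.bc, h.cd, h.de, hxe.symm, hxc, h.bd, h.ce, fun k => hxd k.symm, h.eb⟩

/-- A vertex lies on some induced 5-cycle or misses at most one vertex of the given one. -/
theorem exists_or_adj_four (h : IsInducedC5 G a b c d e) (hx : Near G a b c d e x) :
    (∃ p q r s, IsInducedC5 G x p q r s) ∨
      ∃ m, ∀ p, p = a ∨ p = b ∨ p = c ∨ p = d ∨ p = e → p ≠ m → G.Adj x p := by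
  by_cases hex : ∃ p q r s, IsInducedC5 G x p q r s
  · exact .inl hex
  right
  have xa : x ≠ a := by rintro rfl; exact hex ⟨_, _, _, _, h⟩
  have xb : x ≠ b := by rintro rfl; exact hex ⟨_, _, _, _, h.rotate⟩
  have xc : x ≠ c := by rintro rfl; exact hex ⟨_, _, _, _, h.rotate.rotate⟩
  have xd : x ≠ d := by rintro rfl; exact hex ⟨_, _, _, _, h.rotate.rotate.rotate⟩
  have xe : x ≠ e := by rintro rfl; exact hex ⟨_, _, _, _, h.rotate.rotate.rotate.rotate⟩
  have key {a b c d e : V} (h : IsInducedC5 G a b c d e) (hxe : G.Adj x e) (hxb : G.Adj x b) :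
      G.Adj x c ∨ G.Adj x d := by
    by_contra! hn
    exact hex ⟨_, _, _, _, h.replace hxe hxb hn.1 hn.2⟩
  have ka := key h
  have kb := key h.rotate
  have kc := key h.rotate.rotate
  have kd := key h.rotate.rotate.rotate
  have ke := key h.rotate.rotate.rotate.rotate
  by_contra! hm
  have ma := hm a
  have mb := hm b
  have mc := hm c
  have md := hm d
  have me := hm e
  clear hm hex key
  rcases hx with ⟨hp, hq, hr⟩ | ⟨hp, hq, hr⟩ | ⟨hp, hq, hr⟩ | ⟨hp, hq, hr⟩ |
    ⟨hp, hq, hr⟩ <;> grind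

end IsInducedC5

theorem IsInducedCycle.isInducedC5 {v : ZMod 5 → V} (h : IsInducedCycle G 5 v) :
    IsInducedC5 G (v 0) (v 1) (v 2) (v 3) (v 4) := by
  constructor <;> rw [h.2] <;> decide

end

/-- A connected (claw, bull)-free graph with an induced 5-cycle and no induced cycle of
length at least 6 has independence number at most 2. -/
theorem indepNum_le_two_of_C5 {V : Type*} [Fintype V] (G : SimpleGraph V)
    (hconn : G.Connected) (hclaw : ClawFree G) (hbull : BullFree G)
    (hC5 : ∃ v : ZMod 5 → V, IsInducedCycle G 5 v)
    (hno : ∀ k : ℕ, 6 ≤ k → ∀ v : ZMod k → V, ¬ IsInducedCycle G k v) :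
    ∀ x y z : V, x ≠ y → x ≠ z → y ≠ z → G.Adj x y ∨ G.Adj x z ∨ G.Adj y z := by
  intro x y z hxy hxz hyz
  obtain ⟨v, hv⟩ := hC5
  have h := hv.isInducedC5
  by_contra! hn
  obtain ⟨nxy, nxz, nyz⟩ := hn
  have key (u : V) := h.exists_or_adj_four (h.near hclaw hbull hconn u)
  obtain ⟨p, q, r, s, k⟩ | ⟨m₁, h₁⟩ := key x
  · exact nyz (k.adj_of_not_adj hclaw hbull hconn hxy.symm (fun t => nxy t.symm) hxz.symm
      (fun t => nxz t.symm) hyz)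
  obtain ⟨p, q, r, s, k⟩ | ⟨m₂, h₂⟩ := key y
  · exact nxz (k.adj_of_not_adj hclaw hbull hconn hxy nxy hyz.symm (fun t => nyz t.symm) hxz)
  obtain ⟨p, q, r, s, k⟩ | ⟨m₃, h₃⟩ := key z
  · exact nxy (k.adj_of_not_adj hclaw hbull hconn hxz nxz hyz nyz hxy)
  classical
  obtain ⟨i, hi⟩ : ∃ i : ZMod 5, v i ∉ ({m₁, m₂, m₃} : Finset V) := by
    by_contra! hall
    have h5 := Finset.card_le_card_of_injOn (s := Finset.univ) v (fun i _ => hall i)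
      hv.1.injOn
    have h3 := Finset.card_le_three (a := m₁) (b := m₂) (c := m₃)
    rw [Finset.card_univ, ZMod.card] at h5
    omega
  simp only [Finset.mem_insert, Finset.mem_singleton, not_or] at hi
  have hmem : v i = v 0 ∨ v i = v 1 ∨ v i = v 2 ∨ v i = v 3 ∨ v i = v 4 := by
    have : ∀ i : ZMod 5, i = 0 ∨ i = 1 ∨ i = 2 ∨ i = 3 ∨ i = 4 := by decide
    rcases this i with rfl | rfl | rfl | rfl | rfl <;> simp
  rcases hclaw.exists_adj (h₁ _ hmem hi.1).symm (h₂ _ hmem hi.2.1).symm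
    (h₃ _ hmem hi.2.2).symm hxy hxz hyz with k | k | k
  exacts [nxy k, nxz k, nyz k]
end

section
/- Let G be a finite connected graph that is claw-free and bull-free, contains no induced cycle of length at least 4, and has independence number at least 3 (there exist three pairwise nonadjacent distinct vertices). Then the diameter of G is at least 4. -/
section

variable {V : Type*} {G : SimpleGraph V}

/-- The graph has no induced cycle of length at least four. -/
def NoLongInducedCycle (G : SimpleGraph V) : Prop :=
  ∀ k : ℕ, 4 ≤ k → ∀ v : ZMod k → V, ¬ IsInducedCycle G k v

/-- The five vertices form, in this order, an induced path. -/
def IsInducedPathFive (G : SimpleGraph V) (p q r s t : V) : Prop :=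
  G.Adj p q ∧ G.Adj q r ∧ G.Adj r s ∧ G.Adj s t ∧
    ¬ G.Adj p r ∧ ¬ G.Adj p s ∧ ¬ G.Adj p t ∧ ¬ G.Adj q s ∧ ¬ G.Adj q t ∧ ¬ G.Adj r t

theorem NoLongInducedCycle.four (hG : NoLongInducedCycle G) {a b c d : V}
    (hab : G.Adj a b) (hbc : G.Adj b c) (hcd : G.Adj c d) (hda : G.Adj d a)
    (hac : a ≠ c) (hbd : b ≠ d) : G.Adj a c ∨ G.Adj b d := by
  by_contra! h
  have := hab.ne
  have := hbc.ne
  have := hcd.ne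
  have := hda.ne
  refine hG 4 le_rfl (![a, b, c, d] : Fin 4 → V) ⟨fun (i j : Fin 4) hij => ?_,
    fun (i j : Fin 4) => ?_⟩
  · fin_cases i <;> fin_cases j <;> first | rfl | simp_all
  · change _ ↔ (i - j = 1 ∨ j - i = 1)
    fin_cases i <;> fin_cases j <;> simp_all [G.adj_comm] <;> decide

theorem NoLongInducedCycle.five (hG : NoLongInducedCycle G) {a b c d e : V}
    (hab : G.Adj a b) (hbc : G.Adj b c) (hcd : G.Adj c d) (hde : G.Adj d e) (hea : G.Adj e a) :
    G.Adj a c ∨ G.Adj a d ∨ G.Adj b d ∨ G.Adj b e ∨ G.Adj c e := by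
  by_contra! h
  have key : ∀ i j : Fin 5, G.Adj ((![a, b, c, d, e] : Fin 5 → V) i) (![a, b, c, d, e] j) ↔
      (i - j = 1 ∨ j - i = 1) := by
    intro i j
    fin_cases i <;> fin_cases j <;> simp_all [G.adj_comm] <;> decide
  refine hG 5 (by norm_num) (![a, b, c, d, e] : Fin 5 → V) ⟨fun (i j : Fin 5) hij => ?_, key⟩
  have hinj : ∀ i j : Fin 5, (∀ m : Fin 5,
      (i - m = 1 ∨ m - i = 1) ↔ (j - m = 1 ∨ m - j = 1)) → i = j := by decide
  exact hinj i j fun m => by rw [← key, ← key, hij]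

theorem NoLongInducedCycle.six (hG : NoLongInducedCycle G) {a b c d e f : V}
    (hab : G.Adj a b) (hbc : G.Adj b c) (hcd : G.Adj c d) (hde : G.Adj d e) (hef : G.Adj e f)
    (hfa : G.Adj f a) :
    G.Adj a c ∨ G.Adj a d ∨ G.Adj a e ∨ G.Adj b d ∨ G.Adj b e ∨ G.Adj b f ∨ G.Adj c e ∨
      G.Adj c f ∨ G.Adj d f := by
  by_contra! h
  have key : ∀ i j : Fin 6, G.Adj ((![a, b, c, d, e, f] : Fin 6 → V) i) (![a, b, c, d, e, f] j) ↔
      (i - j = 1 ∨ j - i = 1) := by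
    intro i j
    fin_cases i <;> fin_cases j <;> simp_all [G.adj_comm] <;> decide
  refine hG 6 (by norm_num) (![a, b, c, d, e, f] : Fin 6 → V) ⟨fun (i j : Fin 6) hij => ?_, key⟩
  have hinj : ∀ i j : Fin 6, (∀ m : Fin 6,
      (i - m = 1 ∨ m - i = 1) ↔ (j - m = 1 ∨ m - j = 1)) → i = j := by decide
  exact hinj i j fun m => by rw [← key, ← key, hij]

theorem NoLongInducedCycle.seven (hG : NoLongInducedCycle G) {a b c d e f g : V}
    (hab : G.Adj a b) (hbc : G.Adj b c) (hcd : G.Adj c d) (hde : G.Adj d e) (hef : G.Adj e f)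
    (hfg : G.Adj f g) (hga : G.Adj g a) :
    G.Adj a c ∨ G.Adj a d ∨ G.Adj a e ∨ G.Adj a f ∨ G.Adj b d ∨ G.Adj b e ∨ G.Adj b f ∨
      G.Adj b g ∨ G.Adj c e ∨ G.Adj c f ∨ G.Adj c g ∨ G.Adj d f ∨ G.Adj d g ∨ G.Adj e g := by
  by_contra! h
  have key : ∀ i j : Fin 7, G.Adj ((![a, b, c, d, e, f, g] : Fin 7 → V) i)
      (![a, b, c, d, e, f, g] j) ↔ (i - j = 1 ∨ j - i = 1) := by
    intro i j
    fin_cases i <;> fin_cases j <;> simp_all [G.adj_comm] <;> decide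
  refine hG 7 (by norm_num) (![a, b, c, d, e, f, g] : Fin 7 → V)
    ⟨fun (i j : Fin 7) hij => ?_, key⟩
  have hinj : ∀ i j : Fin 7, (∀ m : Fin 7,
      (i - m = 1 ∨ m - i = 1) ↔ (j - m = 1 ∨ m - j = 1)) → i = j := by decide
  exact hinj i j fun m => by rw [← key, ← key, hij]

theorem BullFree.not_bull (hG : BullFree G) {a b c d e : V} (hab : G.Adj a b) (hbc : G.Adj b c)
    (hca : G.Adj c a) (had : G.Adj a d) (hbe : G.Adj b e) (hbd : ¬ G.Adj b d)
    (hcd : ¬ G.Adj c d) (hae : ¬ G.Adj a e) (hce : ¬ G.Adj c e) (hde : ¬ G.Adj d e) : False := by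
  refine hG ⟨a, b, c, d, e, ?_, ?_, ?_, ?_, ?_, hab, hbc, hca, had, hbe, hbd, hcd, hae, hce, hde⟩
    <;> rintro rfl <;> simp_all [G.adj_comm]

theorem ClawFree.not_claw (hG : ClawFree G) {v a b c : V} (hab : a ≠ b) (hac : a ≠ c)
    (hbc : b ≠ c) (va : G.Adj v a) (vb : G.Adj v b) (vc : G.Adj v c) :
    G.Adj a b ∨ G.Adj a c ∨ G.Adj b c := by
  by_contra! h
  exact hG ⟨v, a, b, c, hab, hac, hbc, va, vb, vc, h.1, h.2.1, h.2.2⟩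

theorem IsInducedPathFive.no_common_neighbor {p q r s t : V} (hP : IsInducedPathFive G p q r s t)
    (hclaw : ClawFree G) (hG : NoLongInducedCycle G) {v : V} (hp : G.Adj p v) (ht : G.Adj v t) :
    False := by
  obtain ⟨pq, qr, rs, st, pr, ps, pt, qs, qt, rt⟩ := hP
  have hpr : p ≠ r := by rintro rfl; exact ps rs
  have hpt : p ≠ t := by rintro rfl; exact ps st.symm
  have hrt : r ≠ t := by rintro rfl; exact qt qr
  have hvr : ¬ G.Adj v r := fun h => by
    rcases hclaw.not_claw hpr hpt hrt hp.symm h ht with h | h | h <;> contradiction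
  by_cases hq : G.Adj v q <;> by_cases hs : G.Adj v s
  · have := hG.four hq qr rs hs.symm (by rintro rfl; exact pr hp) (by rintro rfl; exact ps pq)
    tauto
  · have := hG.five hq qr rs st ht.symm
    tauto
  · have := hG.five hp.symm pq qr rs hs.symm
    tauto
  · have := hG.six hp.symm pq qr rs st ht.symm
    tauto

theorem IsInducedPathFive.four_le_dist {p q r s t : V} (hP : IsInducedPathFive G p q r s t)
    (hconn : G.Connected) (hclaw : ClawFree G) (hbull : BullFree G)
    (hG : NoLongInducedCycle G) : 4 ≤ G.dist p t := by
  have common := fun v => hP.no_common_neighbor hclaw hG (v := v)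
  obtain ⟨pq, qr, rs, st, pr, ps, pt, qs, qt, rt⟩ := hP
  by_contra! hlt
  obtain ⟨w, hw⟩ := hconn.exists_walk_length_eq_dist p t
  rw [← hw] at hlt
  match w, hlt with
  | .nil, _ => exact ps st.symm
  | .cons h .nil, _ => exact pt h
  | .cons h (.cons h' .nil), _ => exact common _ h h'
  | .cons (v := u) pu (.cons (v := v) uv (.cons vt .nil)), _ =>
    have ut : ¬ G.Adj u t := fun h => common _ pu h
    have pv : ¬ G.Adj p v := fun h => common _ h vt
    have ur' : u ≠ r := by rintro rfl; exact pr pu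
    have us' : u ≠ s := by rintro rfl; exact ps pu
    have vq' : v ≠ q := by rintro rfl; exact qt vt
    have vr' : v ≠ r := by rintro rfl; exact rt vt
    have us : ¬ G.Adj u s := fun us => by
      by_cases ur : G.Adj u r
      · exact hbull.not_bull us rs.symm ur.symm pu.symm st (by rwa [G.adj_comm])
          (by rwa [G.adj_comm]) ut rt pt
      by_cases uq : G.Adj u q
      · have := hG.four uq qr rs us.symm ur' (by rintro rfl; exact ps pq)
        tauto
      · have := hG.five pu us rs.symm qr.symm pq.symm
        simp_all [G.adj_comm]
    have qv : ¬ G.Adj q v := fun qv => by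
      by_cases rv : G.Adj r v
      · exact hbull.not_bull qv rv.symm qr.symm pq.symm vt (by rwa [G.adj_comm])
          (by rwa [G.adj_comm]) qt rt pt
      by_cases sv : G.Adj s v
      · have := hG.four qr rs sv qv.symm (by rintro rfl; exact ps pq) vr'.symm
        tauto
      · have := hG.five qr rs st vt.symm qv.symm
        simp_all [G.adj_comm]
    by_cases ur : G.Adj u r <;> by_cases rv : G.Adj r v
    · exact hbull.not_bull uv rv.symm ur.symm pu.symm vt (by rwa [G.adj_comm])
        (by rwa [G.adj_comm]) ut rt pt
    · by_cases sv : G.Adj s v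
      · have := hG.four ur rs sv uv.symm us' vr'.symm
        tauto
      · have := hG.five ur rs st vt.symm uv.symm
        tauto
    · by_cases uq : G.Adj u q
      · have := hG.four uq qr rv uv.symm ur' vq'.symm
        tauto
      · have := hG.five pq qr rv uv.symm pu.symm
        simp_all [G.adj_comm]
    · by_cases uq : G.Adj u q <;> by_cases sv : G.Adj s v
      · have := hG.five uq qr rs sv uv.symm
        tauto
      · have := hG.six uq qr rs st vt.symm uv.symm
        tauto
      · have := hG.six pq qr rs sv uv.symm pu.symm
        simp_all [G.adj_comm]
      · have := hG.seven pq qr rs st vt.symm uv.symm pu.symm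
        simp_all [G.adj_comm]
  | .cons _ (.cons _ (.cons _ (.cons _ _))), h => simp at h; omega

theorem exists_isInducedPathFive (hconn : G.Connected) (hclaw : ClawFree G) (hbull : BullFree G)
    {a x b c : V} (ax : G.Adj a x) (xb : G.Adj x b)
    (hab : a ≠ b) (hac : a ≠ c) (hbc : b ≠ c) (ab : ¬ G.Adj a b) (ac : ¬ G.Adj a c)
    (bc : ¬ G.Adj b c) : ∃ p q r s t, IsInducedPathFive G p q r s t := by
  have xc : ¬ G.Adj x c := fun h => by
    rcases hclaw.not_claw hab hac hbc ax.symm xb h with h | h | h <;> contradiction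
  obtain ⟨w⟩ := hconn.preconnected c a
  obtain ⟨⟨⟨z, y⟩, zy⟩, -, hz, hy⟩ := w.exists_boundary_dart
    {v | v ≠ a ∧ v ≠ x ∧ v ≠ b ∧ ¬ G.Adj a v ∧ ¬ G.Adj x v ∧ ¬ G.Adj b v}
    ⟨hac.symm, by rintro rfl; exact ac ax, hbc.symm, ac, xc, bc⟩ (by simp)
  obtain ⟨hza, hzx, hzb, az, xz, bz⟩ := hz
  change G.Adj z y at zy
  have hya : y ≠ a := by rintro rfl; exact az zy.symm
  have hyx : y ≠ x := by rintro rfl; exact xz zy.symm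
  have hyb : y ≠ b := by rintro rfl; exact bz zy.symm
  have hy' : G.Adj a y ∨ G.Adj x y ∨ G.Adj b y := by
    by_contra! h
    exact hy ⟨hya, hyx, hyb, h⟩
  by_cases ay : G.Adj a y <;> by_cases yb : G.Adj b y
  · have := hclaw.not_claw hab hza.symm hzb.symm ay.symm yb.symm zy.symm
    tauto
  · by_cases xy : G.Adj x y
    · exact (hbull.not_bull xy ay.symm ax xb zy.symm (by simpa [G.adj_comm] using yb) ab xz az
        bz).elim
    · exact ⟨z, y, a, x, b, zy, ay.symm, ax, xb, by simp_all [G.adj_comm]⟩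
  · by_cases xy : G.Adj x y
    · exact (hbull.not_bull xy yb.symm xb.symm ax.symm zy.symm (by simpa [G.adj_comm] using ay)
        (by simpa [G.adj_comm] using ab) xz bz az).elim
    · exact ⟨z, y, b, x, a, zy, yb.symm, xb.symm, ax.symm, by simp_all [G.adj_comm]⟩
  · have xy : G.Adj x y := by tauto
    have := hclaw.not_claw hab hya.symm hyb.symm ax.symm xb xy
    tauto

theorem exists_adj_adj_or_four_le_dist (hconn : G.Connected) {a b : V} (hab : a ≠ b)
    (ab : ¬ G.Adj a b) : (∃ x, G.Adj a x ∧ G.Adj x b) ∨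
      (∃ x y, G.Adj a x ∧ G.Adj x y ∧ G.Adj y b) ∨ 4 ≤ G.dist a b := by
  obtain ⟨w, hw⟩ := hconn.exists_walk_length_eq_dist a b
  rw [← hw]
  match w with
  | .nil => exact (hab rfl).elim
  | .cons h .nil => exact (ab h).elim
  | .cons h (.cons h' .nil) => exact .inl ⟨_, h, h'⟩
  | .cons h (.cons h' (.cons h'' .nil)) => exact .inr (.inl ⟨_, _, h, h', h''⟩)
  | .cons _ (.cons _ (.cons _ (.cons _ _))) => right; right; simp

end

/-- A connected (claw, bull)-free graph with no induced cycle of length at least 4 and with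
independence number at least 3 has diameter at least 4. -/
theorem diam_ge_four {V : Type*} [Fintype V] (G : SimpleGraph V)
    (hconn : G.Connected) (hclaw : ClawFree G) (hbull : BullFree G)
    (hchordal : ∀ k : ℕ, 4 ≤ k → ∀ v : ZMod k → V, ¬ IsInducedCycle G k v)
    (hindep : ∃ a b c : V, a ≠ b ∧ a ≠ c ∧ b ≠ c ∧
      ¬ G.Adj a b ∧ ¬ G.Adj a c ∧ ¬ G.Adj b c) :
    4 ≤ G.diam := by
  have hdiam : ∀ u v, G.dist u v ≤ G.diam := fun u v =>
    SimpleGraph.dist_le_diam (by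
      have := hconn.nonempty
      exact SimpleGraph.connected_iff_ediam_ne_top.mp hconn)
  have far : ∀ {a x b c : V}, G.Adj a x → G.Adj x b → a ≠ b → a ≠ c → b ≠ c → ¬ G.Adj a b →
      ¬ G.Adj a c → ¬ G.Adj b c → 4 ≤ G.diam := fun ax xb hab hac hbc ab ac bc =>
    have ⟨_, _, _, _, _, hP⟩ :=
      exists_isInducedPathFive hconn hclaw hbull ax xb hab hac hbc ab ac bc
    (hP.four_le_dist hconn hclaw hbull hchordal).trans (hdiam _ _)
  obtain ⟨a, b, c, hab, hac, hbc, ab, ac, bc⟩ := hindep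
  rcases exists_adj_adj_or_four_le_dist hconn hab ab with
    ⟨x, ax, xb⟩ | ⟨x, y, ax, xy, yb⟩ | h
  · exact far ax xb hab hac hbc ab ac bc
  · by_cases xc : G.Adj x c
    · exact far ax xc hac hab hbc.symm ac ab (by simpa [G.adj_comm] using bc)
    by_cases yc : G.Adj y c
    · exact far yb.symm yc hbc hab.symm hac.symm bc (by simpa [G.adj_comm] using ab)
        (by simpa [G.adj_comm] using ac)
    by_cases ay : G.Adj a y
    · exact far ay yb hab hac hbc ab ac bc
    · exact far ax xy (by rintro rfl; exact ab yb) hac (by rintro rfl; exact bc yb.symm) ay ac yc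
  · exact h.trans (hdiam _ _)
end

section
/- Let G be a finite connected graph that is claw-free and bull-free, contains no induced cycle of length at least 4, and has independence number at least 3 (there exist three pairwise nonadjacent distinct vertices). Then G is an expansion of a path, i.e., there exist n ≥ 0 and a surjective map f from the vertices of G onto {0, 1, …, n} such that distinct vertices x, y of G are adjacent if and only if |f(x) − f(y)| ≤ 1. -/
/-- `G` is an expansion of the path with `n + 1` vertices. -/
def IsPathExpansion {V : Type*} (G : SimpleGraph V) (n : ℕ) : Prop :=
  ∃ f : V → Fin (n + 1), Function.Surjective f ∧
    ∀ x y : V, x ≠ y →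
      (G.Adj x y ↔ ((f x : ℕ) ≤ (f y : ℕ) + 1 ∧ (f y : ℕ) ≤ (f x : ℕ) + 1))

/-- `G` is an expansion of the cycle of length `k`. -/
def IsCycleExpansion {V : Type*} (G : SimpleGraph V) (k : ℕ) : Prop :=
  ∃ f : V → ZMod k, Function.Surjective f ∧
    ∀ x y : V, x ≠ y →
      (G.Adj x y ↔ (f x = f y ∨ f x - f y = 1 ∨ f y - f x = 1))

/-- The vertices `p 0, …, p n` form an induced path of length `n` in `G`. -/
def IsInducedPath {V : Type*} (G : SimpleGraph V) (n : ℕ) (p : ℕ → V) : Prop :=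
  (∀ i j, i ≤ n → j ≤ n → p i = p j → i = j) ∧
    ∀ i j, i ≤ n → j ≤ n → (G.Adj (p i) (p j) ↔ (i = j + 1 ∨ j = i + 1))

/-- The closed neighbourhood of `x` on `p 0, …, p n` is the one of `p k` in an induced path. -/
def HasWindow {V : Type*} (G : SimpleGraph V) (n : ℕ) (p : ℕ → V) (x : V) (k : ℕ) : Prop :=
  ∀ i, i ≤ n → ((x = p i ∨ G.Adj x (p i)) ↔ (i ≤ k + 1 ∧ k ≤ i + 1))

section InducedPath

variable {V : Type*} {G : SimpleGraph V} {n : ℕ} {p : ℕ → V}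

lemma IsInducedPath.reverse (hp : IsInducedPath G n p) :
    IsInducedPath G n (fun i => p (n - i)) := by
  refine ⟨fun i j hi hj h => ?_, fun i j hi hj => ?_⟩
  · have := hp.1 _ _ (Nat.sub_le n i) (Nat.sub_le n j) h
    omega
  · rw [hp.2 _ _ (Nat.sub_le n i) (Nat.sub_le n j)]
    omega

lemma IsInducedPath.append (hp : IsInducedPath G n p) {x : V} (hx : ∀ i ≤ n, x ≠ p i)
    (hadj : ∀ i ≤ n, (G.Adj x (p i) ↔ i = n)) :
    IsInducedPath G (n + 1) (Function.update p (n + 1) x) := by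
  refine ⟨fun i j hi hj => ?_, fun i j hi hj => ?_⟩
  · rcases Nat.lt_or_eq_of_le hi with hi' | rfl <;> rcases Nat.lt_or_eq_of_le hj with hj' | rfl
    · rw [Function.update_of_ne (by omega), Function.update_of_ne (by omega)]
      exact hp.1 i j (by omega) (by omega)
    · rw [Function.update_of_ne (by omega), Function.update_self]
      exact fun h => (hx i (by omega) h.symm).elim
    · rw [Function.update_of_ne (by omega : j ≠ n + 1), Function.update_self]
      exact fun h => (hx j (by omega) h).elim
    · simp
  · rcases Nat.lt_or_eq_of_le hi with hi' | rfl <;> rcases Nat.lt_or_eq_of_le hj with hj' | rfl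
    · rw [Function.update_of_ne (by omega), Function.update_of_ne (by omega)]
      exact hp.2 i j (by omega) (by omega)
    · rw [Function.update_of_ne (by omega), Function.update_self, G.adj_comm,
        hadj i (by omega)]
      omega
    · rw [Function.update_of_ne (by omega : j ≠ n + 1), Function.update_self,
        hadj j (by omega)]
      omega
    · simp

lemma IsInducedPath.prepend (hp : IsInducedPath G n p) {x : V} (hx : ∀ i ≤ n, x ≠ p i)
    (hadj : ∀ i ≤ n, (G.Adj x (p i) ↔ i = 0)) :
    ∃ q, IsInducedPath G (n + 1) q :=
  ⟨_, hp.reverse.append (fun i _ => hx _ (Nat.sub_le n i))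
    (fun i hi => (hadj _ (Nat.sub_le n i)).trans (by omega))⟩

lemma IsInducedPath.hasWindow_self (hp : IsInducedPath G n p) {i : ℕ} (hi : i ≤ n) :
    HasWindow G n p (p i) i := by
  intro j hj
  have h1 := hp.1 i j hi hj
  rw [hp.2 i j hi hj]
  constructor
  · rintro (h | h)
    · have := h1 h
      omega
    · omega
  · intro h
    rcases eq_or_ne i j with rfl | hne
    · exact Or.inl rfl
    · right
      omega

/-- Indices of an interval `[0, n]` with `4 ≤ n` have distinct windows, even after deleting one
index from them, with exceptions at the ends. -/
lemma window_eq_or {i j k : ℕ} (hn : 4 ≤ n) (hj : j ≤ n) (hk : k ≤ n)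
    (h : ∀ m, m ≤ n → m ≠ i → ((m ≤ k + 1 ∧ k ≤ m + 1) ↔ (m ≤ j + 1 ∧ j ≤ m + 1))) :
    k = j ∨ (j ≤ 1 ∧ k ≤ 1 ∧ i = 2) ∨ (n ≤ j + 1 ∧ n ≤ k + 1 ∧ i + 2 = n) := by
  have h1 := h (k - 1)
  have h2 := h k
  have h3 := h (k + 1)
  have h4 := h (j - 1)
  have h5 := h j
  have h6 := h (j + 1)
  omega

lemma IsInducedPath.eq_of_hasWindow (hp : IsInducedPath G n p) (hn : 4 ≤ n) {i k : ℕ}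
    (hi : i ≤ n) (hk : k ≤ n) (h : HasWindow G n p (p i) k) : k = i := by
  have h1 := fun m hm => (h m hm).symm.trans (hp.hasWindow_self hi m hm)
  have h2 := window_eq_or (i := n + 1) hn hi hk (fun m hm _ => h1 m hm)
  omega

lemma IsInducedPath.update (hp : IsInducedPath G n p) (hn : 4 ≤ n) {x : V} {k : ℕ}
    (hk : k ≤ n) (h : HasWindow G n p x k) :
    IsInducedPath G n (Function.update p k x) := by
  have hne : ∀ i ≤ n, i ≠ k → x ≠ p i := by
    rintro i hi hik rfl
    exact hik (hp.eq_of_hasWindow hn hi hk h).symm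
  refine ⟨fun i j hi hj => ?_, fun i j hi hj => ?_⟩
  · rcases eq_or_ne i k with rfl | hik <;> rcases eq_or_ne j i with rfl | hji
    · simp
    · rw [Function.update_self, Function.update_of_ne hji]
      exact fun h => (hne j hj hji h).elim
    · simp
    · rcases eq_or_ne j k with rfl | hjk
      · rw [Function.update_self, Function.update_of_ne hik]
        exact fun h => (hne i hi hik h.symm).elim
      · rw [Function.update_of_ne hik, Function.update_of_ne hjk]
        exact hp.1 i j hi hj
  · have key : ∀ m ≤ n, m ≠ k → (G.Adj x (p m) ↔ (m = k + 1 ∨ k = m + 1)) := by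
      intro m hm hmk
      have h1 := h m hm
      rw [or_iff_right (hne m hm hmk)] at h1
      rw [h1]
      omega
    rcases eq_or_ne i k with rfl | hik <;> rcases eq_or_ne j i with rfl | hji
    · simp
    · rw [Function.update_self, Function.update_of_ne hji, key j hj hji]
      omega
    · simp
    · rcases eq_or_ne j k with rfl | hjk
      · rw [Function.update_self, Function.update_of_ne hik, G.adj_comm, key i hi hik]
      · rw [Function.update_of_ne hik, Function.update_of_ne hjk]
        exact hp.2 i j hi hj

end InducedPath

lemma ZMod.sub_eq_one_iff_val {k : ℕ} (hk : 2 ≤ k) (a b : ZMod k) :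
    a - b = 1 ↔ (a.val = b.val + 1 ∨ (a.val = 0 ∧ b.val + 1 = k)) := by
  have : NeZero k := ⟨by omega⟩
  have : Fact (1 < k) := ⟨by omega⟩
  have ha := a.val_lt
  have hb := b.val_lt
  rw [sub_eq_iff_eq_add, add_comm, ← (ZMod.val_injective k).eq_iff, ZMod.val_add, ZMod.val_one]
  rcases Nat.lt_or_ge (b.val + 1) k with h | h
  · rw [Nat.mod_eq_of_lt h]
    omega
  · have : b.val + 1 = k := by omega
    rw [this, Nat.mod_self]
    omega

section Chordal

variable {V : Type*} {G : SimpleGraph V} {n : ℕ} {p : ℕ → V}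

/-- In a chordal graph a vertex cannot see two vertices of an induced path but nothing strictly
between them. -/
lemma IsInducedPath.exists_adj_between
    (hchordal : ∀ k : ℕ, 4 ≤ k → ∀ v : ZMod k → V, ¬ IsInducedCycle G k v)
    (hp : IsInducedPath G n p) {x : V} (hx : ∀ i ≤ n, x ≠ p i) {i j : ℕ} (hij : i + 2 ≤ j)
    (hj : j ≤ n) (hi : G.Adj x (p i)) (hj' : G.Adj x (p j)) :
    ∃ m, i < m ∧ m < j ∧ G.Adj x (p m) := by
  by_contra! hno
  have hk : NeZero (j - i + 2) := ⟨by omega⟩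
  have hadj : ∀ m, i ≤ m → m ≤ j → (G.Adj x (p m) ↔ (m = i ∨ m = j)) := by
    intro m h1 h2
    constructor
    · intro h
      by_contra hc
      exact hno m (by omega) (by omega) h
    · rintro (rfl | rfl) <;> assumption
  refine hchordal (j - i + 2) (by omega)
    (fun t => if t.val = 0 then x else p (i + t.val - 1)) ⟨fun a b hab => ?_, fun a b => ?_⟩
  · have ha := a.val_lt
    have hb := b.val_lt
    apply ZMod.val_injective
    dsimp only at hab
    split_ifs at hab with h1 h2 h2
    · omega
    · exact (hx _ (by omega) hab).elim
    · exact (hx _ (by omega) hab.symm).elim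
    · have := hp.1 _ _ (by omega) (by omega) hab
      omega
  · rw [ZMod.sub_eq_one_iff_val (by omega), ZMod.sub_eq_one_iff_val (by omega)]
    have ha := a.val_lt
    have hb := b.val_lt
    dsimp only
    split_ifs with h1 h2 h2
    · simp only [SimpleGraph.irrefl, false_iff]
      omega
    · rw [hadj _ (by omega) (by omega)]
      omega
    · rw [G.adj_comm, hadj _ (by omega) (by omega)]
      omega
    · rw [hp.2 _ _ (by omega) (by omega)]
      omega

lemma IsInducedPath.adj_of_between
    (hchordal : ∀ k : ℕ, 4 ≤ k → ∀ v : ZMod k → V, ¬ IsInducedCycle G k v)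
    (hp : IsInducedPath G n p) {x : V} (hx : ∀ i ≤ n, x ≠ p i) {i j m : ℕ} (him : i ≤ m)
    (hmj : m ≤ j) (hj : j ≤ n) (hi : G.Adj x (p i)) (hj' : G.Adj x (p j)) :
    G.Adj x (p m) := by
  induction h : j - i using Nat.strong_induction_on generalizing i j with
  | _ d ih =>
    subst h
    rcases eq_or_ne m i with rfl | hmi
    · exact hi
    rcases eq_or_ne m j with rfl | hmj'
    · exact hj'
    obtain ⟨l, hil, hlj, hl⟩ := hp.exists_adj_between hchordal hx (by omega) hj hi hj'
    rcases le_total m l with h | h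
    · exact ih (l - i) (by omega) him h (by omega) hi hl rfl
    · exact ih (j - l) (by omega) h hmj hj hl hj' rfl

/-- A vertex outside a longest induced path, with a neighbour on it, attaches to it like one of
its vertices. -/
lemma IsInducedPath.exists_hasWindow_of_adj (hclaw : ClawFree G) (hbull : BullFree G)
    (hchordal : ∀ k : ℕ, 4 ≤ k → ∀ v : ZMod k → V, ¬ IsInducedCycle G k v)
    (hp : IsInducedPath G n p) (hn : 4 ≤ n) (hmax : ∀ q, ¬ IsInducedPath G (n + 1) q)
    {x : V} (hx : ∀ i ≤ n, x ≠ p i) (hadj : ∃ i ≤ n, G.Adj x (p i)) :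
    ∃ k ≤ n, HasWindow G n p x k := by
  classical
  obtain ⟨l, hl, hlmin⟩ : ∃ l, (l ≤ n ∧ G.Adj x (p l)) ∧
      ∀ m, m ≤ n → G.Adj x (p m) → l ≤ m :=
    ⟨Nat.find hadj, Nat.find_spec hadj, fun m h1 h2 => Nat.find_min' hadj ⟨h1, h2⟩⟩
  obtain ⟨r, hr, hrmax⟩ : ∃ r, (r ≤ n ∧ G.Adj x (p r)) ∧
      ∀ m, m ≤ n → G.Adj x (p m) → m ≤ r :=
    ⟨Nat.findGreatest (fun i => G.Adj x (p i)) n,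
      ⟨Nat.findGreatest_le n, Nat.findGreatest_spec (P := fun i => G.Adj x (p i)) hl.1 hl.2⟩,
      fun m h1 h2 => Nat.le_findGreatest h1 h2⟩
  have hlr : l ≤ r := hlmin r hr.1 hr.2
  have hA : ∀ m ≤ n, (G.Adj x (p m) ↔ (l ≤ m ∧ m ≤ r)) := fun m hm =>
    ⟨fun h => ⟨hlmin m hm h, hrmax m hm h⟩,
      fun h => hp.adj_of_between hchordal hx h.1 h.2 hr.1 hl.2 hr.2⟩
  have hpne : ∀ i j, i ≤ n → j ≤ n → i ≠ j → p i ≠ p j := fun i j hi hj h h' =>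
    h (hp.1 i j hi hj h')
  have hwin : ∀ k ≤ n, (∀ m ≤ n, ((l ≤ m ∧ m ≤ r) ↔ (m ≤ k + 1 ∧ k ≤ m + 1))) →
      ∃ k ≤ n, HasWindow G n p x k := fun k hk h =>
    ⟨k, hk, fun m hm => by rw [or_iff_right (hx m hm), hA m hm, h m hm]⟩
  have hlr3 : r ≤ l + 3 := by
    by_contra h
    refine hclaw ⟨x, p l, p (l + 2), p (l + 4), hpne _ _ (by omega) (by omega) (by omega),
      hpne _ _ (by omega) (by omega) (by omega), hpne _ _ (by omega) (by omega) (by omega),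
      hl.2, ?_, ?_, ?_, ?_, ?_⟩
    all_goals first
      | rw [hp.2 _ _ (by omega) (by omega)]; omega
      | rw [hA _ (by omega)]; omega
  obtain h | h | h | h : r = l ∨ r = l + 1 ∨ r = l + 2 ∨ r = l + 3 := by omega
  · rcases Nat.eq_zero_or_pos l with h0 | h0
    · obtain ⟨q, hq⟩ := hp.prepend hx (fun i hi => (hA i hi).trans (by omega))
      exact (hmax q hq).elim
    rcases Nat.lt_or_ge r n with h1 | h1
    · refine (hclaw ⟨p l, x, p (l - 1), p (l + 1), hx _ (by omega), hx _ (by omega),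
        hpne _ _ (by omega) (by omega) (by omega), hl.2.symm, ?_, ?_, ?_, ?_, ?_⟩).elim
      all_goals first
        | rw [hp.2 _ _ (by omega) (by omega)]; omega
        | rw [hA _ (by omega)]; omega
    · exact (hmax _ (hp.append hx (fun i hi => (hA i hi).trans (by omega)))).elim
  · rcases Nat.eq_zero_or_pos l with h0 | h0
    · exact hwin 0 (by omega) (by omega)
    rcases Nat.lt_or_ge r n with h1 | h1
    · refine (hbull ⟨p l, p r, x, p (l - 1), p (r + 1), hpne _ _ (by omega) (by omega) (by omega),
        hpne _ _ (by omega) (by omega) (by omega), hx _ (by omega), hx _ (by omega),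
        hpne _ _ (by omega) (by omega) (by omega), ?_, hr.2.symm, hl.2, ?_, ?_, ?_, ?_, ?_, ?_,
        ?_⟩).elim
      all_goals first
        | rw [hp.2 _ _ (by omega) (by omega)]; omega
        | rw [hA _ (by omega)]; omega
    · exact hwin n le_rfl (by omega)
  · exact hwin (l + 1) (by omega) (by omega)
  · rcases Nat.lt_or_ge r n with h1 | h1
    · refine (hbull ⟨x, p r, p (r - 1), p l, p (r + 1), hx _ (by omega),
        hpne _ _ (by omega) (by omega) (by omega), hpne _ _ (by omega) (by omega) (by omega),
        hpne _ _ (by omega) (by omega) (by omega), hpne _ _ (by omega) (by omega) (by omega),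
        hr.2, ?_, SimpleGraph.Adj.symm ?_, hl.2, ?_, ?_, ?_, ?_, ?_, ?_⟩).elim
      all_goals first
        | rw [hp.2 _ _ (by omega) (by omega)]; omega
        | rw [hA _ (by omega)]; omega
    · refine (hbull ⟨x, p l, p (l + 1), p r, p (l - 1), hx _ (by omega),
        hpne _ _ (by omega) (by omega) (by omega), hpne _ _ (by omega) (by omega) (by omega),
        hpne _ _ (by omega) (by omega) (by omega), hpne _ _ (by omega) (by omega) (by omega),
        hl.2, ?_, SimpleGraph.Adj.symm ?_, hr.2, ?_, ?_, ?_, ?_, ?_, ?_⟩).elim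
      all_goals first
        | rw [hp.2 _ _ (by omega) (by omega)]; omega
        | rw [hA _ (by omega)]; omega

/-- Every vertex attaches to a longest induced path like one of its vertices. -/
lemma IsInducedPath.exists_hasWindow (hconn : G.Connected) (hclaw : ClawFree G)
    (hbull : BullFree G)
    (hchordal : ∀ k : ℕ, 4 ≤ k → ∀ v : ZMod k → V, ¬ IsInducedCycle G k v)
    (hp : IsInducedPath G n p) (hn : 4 ≤ n) (hmax : ∀ q, ¬ IsInducedPath G (n + 1) q) (x : V) :
    ∃ k ≤ n, HasWindow G n p x k := by
  have hreach := (SimpleGraph.reachable_iff_reflTransGen _ _).1 (hconn.preconnected (p 0) x)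
  induction hreach with
  | refl => exact ⟨0, by omega, hp.hasWindow_self (by omega)⟩
  | @tail y x _ hyx ih =>
    obtain ⟨k, hk, hy⟩ := ih
    by_cases hx : ∀ i ≤ n, x ≠ p i
    · by_cases hadj : ∃ i ≤ n, G.Adj x (p i)
      · exact hp.exists_hasWindow_of_adj hclaw hbull hchordal hn hmax hx hadj
      push Not at hadj
      have hyp : ∀ i ≤ n, y ≠ p i := by
        rintro i hi rfl
        exact hadj i hi hyx.symm
      have hA : ∀ i ≤ n, (G.Adj y (p i) ↔ (i ≤ k + 1 ∧ k ≤ i + 1)) := fun i hi => by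
        rw [← hy i hi, or_iff_right (hyp i hi)]
      have hp' := hp.update hn hk hy
      have hx' : ∀ i ≤ n, x ≠ Function.update p k y i := by
        intro i hi
        rcases eq_or_ne i k with rfl | hik
        · rw [Function.update_self]
          exact hyx.ne'
        · rw [Function.update_of_ne hik]
          exact hx i hi
      have hadj' : ∀ i ≤ n, (G.Adj x (Function.update p k y i) ↔ i = k) := by
        intro i hi
        rcases eq_or_ne i k with rfl | hik
        · rw [Function.update_self]
          exact ⟨fun _ => rfl, fun _ => hyx.symm⟩
        · rw [Function.update_of_ne hik]
          exact ⟨fun h => (hadj i hi h).elim, fun h => (hik h).elim⟩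
      rcases Nat.eq_zero_or_pos k with rfl | h0
      · obtain ⟨q, hq⟩ := hp'.prepend hx' hadj'
        exact (hmax q hq).elim
      rcases Nat.lt_or_ge k n with h1 | h1
      · refine (hclaw ⟨y, x, p (k - 1), p (k + 1), hx _ (by omega), hx _ (by omega),
          fun h => ?_, hyx, ?_, ?_, hadj _ (by omega), hadj _ (by omega), ?_⟩).elim
        · have := hp.1 _ _ (by omega) (by omega) h
          omega
        · rw [hA _ (by omega)]
          omega
        · rw [hA _ (by omega)]
          omega
        · rw [hp.2 _ _ (by omega) (by omega)]
          omega
      · obtain rfl : k = n := by omega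
        exact (hmax _ (hp'.append hx' hadj')).elim
    · push Not at hx
      obtain ⟨i, hi, rfl⟩ := hx
      exact ⟨i, hi, hp.hasWindow_self hi⟩

end Chordal

section LongInducedPath

variable {V : Type*} {G : SimpleGraph V}

lemma isInducedPath_four {a b c d e : V} (hab : G.Adj a b) (hbc : G.Adj b c) (hcd : G.Adj c d)
    (hde : G.Adj d e) (hac : ¬ G.Adj a c) (had : ¬ G.Adj a d) (hae : ¬ G.Adj a e)
    (hbd : ¬ G.Adj b d) (hbe : ¬ G.Adj b e) (hce : ¬ G.Adj c e) :
    ∃ p, IsInducedPath G 4 p := by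
  refine ⟨fun i => if i = 0 then a else if i = 1 then b else if i = 2 then c else
    if i = 3 then d else e, fun i j hi hj => ?_, fun i j hi hj => ?_⟩ <;>
  interval_cases i <;> interval_cases j <;> grind [SimpleGraph.adj_comm, SimpleGraph.irrefl]

/-- In a connected graph without induced path of length `4`, distances are at most `3`. -/
lemma exists_short_walk (hconn : G.Connected) (hP : ∀ p, ¬ IsInducedPath G 4 p) (a b : V) :
    a = b ∨ G.Adj a b ∨ (∃ u, G.Adj a u ∧ G.Adj u b) ∨
      ∃ u v, G.Adj a u ∧ G.Adj u v ∧ G.Adj v b := by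
  have hreach := (SimpleGraph.reachable_iff_reflTransGen _ _).1 (hconn.preconnected a b)
  induction hreach with
  | refl => exact Or.inl rfl
  | @tail y z _ hyz ih =>
    rcases ih with rfl | h | ⟨u, hu, huy⟩ | ⟨u, v, hu, huv, hvy⟩
    · exact Or.inr (Or.inl hyz)
    · exact Or.inr (Or.inr (Or.inl ⟨y, h, hyz⟩))
    · exact Or.inr (Or.inr (Or.inr ⟨u, y, hu, huy, hyz⟩))
    · by_contra! hno
      obtain ⟨h0, h1, h2, h3⟩ := hno
      obtain ⟨p, hp⟩ := isInducedPath_four hu huv hvy hyz (fun h => h3 v y h hvy hyz)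
        (fun h => h2 y h hyz) h1 (fun h => h3 u y hu h hyz) (fun h => h2 u hu h)
        (fun h => h3 u v hu huv h)
      exact hP p hp

/-- Without claws, bulls and induced paths of length `4`, a stable triple contains at most one
pair of vertices with a common neighbour. -/
lemma false_of_common_neighbors (hclaw : ClawFree G) (hbull : BullFree G)
    (hP : ∀ p, ¬ IsInducedPath G 4 p) {a b c u w : V} (hab : a ≠ b) (hac : a ≠ c) (hbc : b ≠ c)
    (nab : ¬ G.Adj a b) (nac : ¬ G.Adj a c) (nbc : ¬ G.Adj b c)
    (hua : G.Adj a u) (hub : G.Adj u b) (hwb : G.Adj b w) (hwc : G.Adj w c) : False := by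
  have huc : ¬ G.Adj u c := fun h =>
    hclaw ⟨u, a, b, c, hab, hac, hbc, hua.symm, hub, h, nab, nac, nbc⟩
  have hwa : ¬ G.Adj a w := fun h =>
    hclaw ⟨w, a, b, c, hab, hac, hbc, h.symm, hwb.symm, hwc, nab, nac, nbc⟩
  by_cases huw : G.Adj u w
  · exact hbull ⟨u, w, b, a, c, by rintro rfl; exact nac hua, by rintro rfl; exact nab hwb.symm,
      hab.symm, hbc, hac, huw, hwb.symm, hub.symm, hua.symm, hwc, fun h => hwa h.symm,
      fun h => nab h.symm, huc, nbc, nac⟩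
  · obtain ⟨p, hp⟩ := isInducedPath_four hua hub hwb hwc nab hwa nac huw huc nbc
    exact hP p hp

lemma false_of_far_pairs (hconn : G.Connected) (hclaw : ClawFree G) (hbull : BullFree G)
    (hP : ∀ p, ¬ IsInducedPath G 4 p) {a b c : V} (hab : a ≠ b) (hac : a ≠ c) (hbc : b ≠ c)
    (nab : ¬ G.Adj a b) (nac : ¬ G.Adj a c) (nbc : ¬ G.Adj b c)
    (dab : ∀ u, G.Adj a u → ¬ G.Adj u b) (dac : ∀ u, G.Adj a u → ¬ G.Adj u c) : False := by
  obtain ⟨x, y, hax, hxy, hyb⟩ : ∃ x y, G.Adj a x ∧ G.Adj x y ∧ G.Adj y b := by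
    have := exists_short_walk hconn hP a b
    grind
  obtain ⟨w, z, haw, hwz, hzc⟩ : ∃ w z, G.Adj a w ∧ G.Adj w z ∧ G.Adj z c := by
    have := exists_short_walk hconn hP a c
    grind
  have nay : ¬ G.Adj a y := fun h => dab y h hyb
  have naz : ¬ G.Adj a z := fun h => dac z h hzc
  have nxb := dab x hax
  have nxc := dac x hax
  have hxb : x ≠ b := by rintro rfl; exact nab hax
  have hxc : x ≠ c := by rintro rfl; exact nac hax
  have hay : a ≠ y := by rintro rfl; exact nab hyb
  have nyc : ¬ G.Adj y c := fun h =>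
    hclaw ⟨y, x, b, c, hxb, hxc, hbc, hxy.symm, hyb, h, nxb, nxc, nbc⟩
  have hyc : y ≠ c := by rintro rfl; exact nxc hxy
  have nxz : ¬ G.Adj x z := fun h =>
    false_of_common_neighbors hclaw hbull hP hxb.symm hbc hxc
      (fun h => nxb h.symm) nbc nxc hyb.symm hxy.symm h hzc
  have nyz : ¬ G.Adj y z := fun h =>
    false_of_common_neighbors hclaw hbull hP hay hac hyc nay nac nyc hax hxy h hzc
  have hzy : z ≠ y := by rintro rfl; exact nyc hzc
  have hza : z ≠ a := by rintro rfl; exact nac hzc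
  have nwy : ¬ G.Adj w y := fun h =>
    hclaw ⟨w, z, a, y, hza, hzy, hay, hwz, haw.symm, h, fun h => naz h.symm,
      fun h => nyz h.symm, nay⟩
  by_cases hwx : G.Adj w x
  · exact hbull ⟨w, x, a, z, y, by rintro rfl; exact nay haw, by rintro rfl; exact nxc hzc,
      hza.symm, hay, hzy, hwx, hax.symm, haw, hwz, hxy, nxz, naz, nwy, nay,
      fun h => nyz h.symm⟩
  · obtain ⟨p, hp⟩ := isInducedPath_four hwz.symm haw.symm hax hxy (fun h => naz h.symm)
      (fun h => nxz h.symm) (fun h => nyz h.symm) hwx nwy nay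
    exact hP p hp

lemma exists_isInducedPath_four (hconn : G.Connected) (hclaw : ClawFree G) (hbull : BullFree G)
    (hindep : ∃ a b c : V, a ≠ b ∧ a ≠ c ∧ b ≠ c ∧
      ¬ G.Adj a b ∧ ¬ G.Adj a c ∧ ¬ G.Adj b c) :
    ∃ p, IsInducedPath G 4 p := by
  by_contra! hP
  obtain ⟨a, b, c, hab, hac, hbc, nab, nac, nbc⟩ := hindep
  have nba : ¬ G.Adj b a := fun h => nab h.symm
  have nca : ¬ G.Adj c a := fun h => nac h.symm
  have ncb : ¬ G.Adj c b := fun h => nbc h.symm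
  by_cases dab : ∀ u, G.Adj a u → ¬ G.Adj u b
  · by_cases dac : ∀ u, G.Adj a u → ¬ G.Adj u c
    · exact false_of_far_pairs hconn hclaw hbull hP hab hac hbc nab nac nbc dab dac
    by_cases dbc : ∀ u, G.Adj b u → ¬ G.Adj u c
    · exact false_of_far_pairs hconn hclaw hbull hP hab.symm hbc hac nba nbc nac
        (fun u h h' => dab u h'.symm h.symm) dbc
    push Not at dac dbc
    obtain ⟨u, hu, hu'⟩ := dac
    obtain ⟨w, hw, hw'⟩ := dbc
    exact false_of_common_neighbors hclaw hbull hP hac hab hbc.symm nac nab ncb hu hu'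
      hw'.symm hw.symm
  · push Not at dab
    obtain ⟨u, hu, hu'⟩ := dab
    refine false_of_far_pairs hconn hclaw hbull hP hac.symm hbc.symm hab nca ncb nab
      (fun w h h' => ?_) (fun w h h' => ?_)
    · exact false_of_common_neighbors hclaw hbull hP hab.symm hbc hac nba nbc nac hu'.symm
        hu.symm h'.symm h.symm
    · exact false_of_common_neighbors hclaw hbull hP hab hac hbc nab nac nbc hu hu' h'.symm
        h.symm

end LongInducedPath

lemma exists_maximal_isInducedPath {V : Type*} [Fintype V] {G : SimpleGraph V} {m : ℕ}
    (h : ∃ p, IsInducedPath G m p) :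
    ∃ n p, m ≤ n ∧ IsInducedPath G n p ∧ ∀ q, ¬ IsInducedPath G (n + 1) q := by
  classical
  have hbound : ∀ n, (∃ p, IsInducedPath G n p) → n ≤ Fintype.card V := by
    rintro n ⟨p, hp⟩
    have := Fintype.card_le_of_injective (fun i : Fin (n + 1) => p i) fun i j hij =>
      Fin.ext (hp.1 i j (by omega) (by omega) hij)
    simp only [Fintype.card_fin] at this
    omega
  set n := Nat.findGreatest (fun n => ∃ p, IsInducedPath G n p) (Fintype.card V) with hn
  obtain ⟨p, hp⟩ : ∃ p, IsInducedPath G n p :=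
    Nat.findGreatest_spec (P := fun n => ∃ p, IsInducedPath G n p) (hbound m h) h
  refine ⟨n, p, Nat.le_findGreatest (hbound m h) h, hp, fun q hq => ?_⟩
  have : n + 1 ≤ n :=
    Nat.le_findGreatest (P := fun n => ∃ p, IsInducedPath G n p) (hbound _ ⟨q, hq⟩) ⟨q, hq⟩
  omega

/-- If `y` has window `k` after `x` replaces the path vertex `p i`, then `k` determines whether
`x` and `y` are adjacent, and `k` is the original window of `y`, with exceptions at the ends. -/
lemma HasWindow.adj_iff_and_eq_or {V : Type*} {G : SimpleGraph V} {n : ℕ} {p : ℕ → V} (hn : 4 ≤ n)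
    {x y : V} (hxy : x ≠ y) {i j k : ℕ} (hi : i ≤ n) (hj : j ≤ n) (hk : k ≤ n)
    (hy : HasWindow G n p y j) (hy' : HasWindow G n (Function.update p i x) y k) :
    (G.Adj x y ↔ (i ≤ k + 1 ∧ k ≤ i + 1)) ∧
      (k = j ∨ (j ≤ 1 ∧ k ≤ 1 ∧ i = 2) ∨ (n ≤ j + 1 ∧ n ≤ k + 1 ∧ i + 2 = n)) := by
  constructor
  · rw [← hy' i hi, Function.update_self, G.adj_comm, or_iff_right hxy.symm]
  · refine window_eq_or hn hj hk fun m hm hmi => ?_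
    rw [← hy m hm, ← hy' m hm, Function.update_of_ne hmi]

/-- A connected (claw, bull)-free graph with no induced cycle of length at least 4 and with
independence number at least 3 is an expansion of a path. -/
theorem pathExpansion_of_chordal {V : Type*} [Fintype V] (G : SimpleGraph V)
    (hconn : G.Connected) (hclaw : ClawFree G) (hbull : BullFree G)
    (hchordal : ∀ k : ℕ, 4 ≤ k → ∀ v : ZMod k → V, ¬ IsInducedCycle G k v)
    (hindep : ∃ a b c : V, a ≠ b ∧ a ≠ c ∧ b ≠ c ∧
      ¬ G.Adj a b ∧ ¬ G.Adj a c ∧ ¬ G.Adj b c) :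
    ∃ n : ℕ, IsPathExpansion G n := by
  obtain ⟨n, p, hn, hp, hmax⟩ :=
    exists_maximal_isInducedPath (exists_isInducedPath_four hconn hclaw hbull hindep)
  have hwin := fun {q} (hq : IsInducedPath G n q) =>
    hq.exists_hasWindow hconn hclaw hbull hchordal hn hmax
  choose k hk hkw using hwin hp
  refine ⟨n, fun x => ⟨k x, Nat.lt_succ_of_le (hk x)⟩, fun i => ⟨p i, Fin.ext ?_⟩,
    fun x y hxy => ?_⟩
  · exact hp.eq_of_hasWindow hn (by omega) (hk _) (hkw _)
  · obtain ⟨k₁, hk₁, h₁⟩ := hwin (hp.update hn (hk x) (hkw x)) y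
    obtain ⟨k₂, hk₂, h₂⟩ := hwin (hp.update hn (hk y) (hkw y)) x
    obtain ⟨e₁, c₁⟩ := HasWindow.adj_iff_and_eq_or hn hxy (hk x) (hk y) hk₁ (hkw y) h₁
    obtain ⟨e₂, c₂⟩ := HasWindow.adj_iff_and_eq_or hn hxy.symm (hk y) (hk x) hk₂ (hkw x) h₂
    rw [G.adj_comm, e₁] at e₂
    rw [e₁]
    dsimp only
    omega
end

section
/- Let G be a finite connected graph that is claw-free and bull-free, contains no induced cycle of length at least 4, and has independence number at least 3 (there exist three pairwise nonadjacent distinct vertices). Let k = diam(G), let v_0 and v_k be vertices with d(v_0, v_k) = k, and let v_1 be a neighbor of v_0 with d(v_1, v_k) = k − 1. Then every neighbor u of v_0 with u ≠ v_1 is adjacent to v_1. -/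
/-- The spanning subgraph of `G` keeping only the edges with both ends in `T`. -/
abbrev SimpleGraph.restrictTo {V : Type*} (G : SimpleGraph V) (T : Set V) : SimpleGraph V :=
  ((⊤ : G.Subgraph).induce T).spanningCoe

/-- An induced cycle can be given by a sequence indexed by natural numbers. -/
lemma isInducedCycle_of_nat {V : Type*} {G : SimpleGraph V} {m : ℕ} (hm : 2 ≤ m) {c : ℕ → V}
    (hinj : ∀ i j, i < j → j < m → c i ≠ c j)
    (hadj : ∀ i j, i < j → j < m → (G.Adj (c i) (c j) ↔ j = i + 1 ∨ (i = 0 ∧ j + 1 = m))) :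
    IsInducedCycle G m (fun i : ZMod m ↦ c i.val) := by
  have : NeZero m := ⟨by omega⟩
  have hsub (i j : ZMod m) :
      i - j = 1 ↔ i.val = j.val + 1 ∨ (i.val = 0 ∧ j.val + 1 = m) := by
    have hi := i.val_lt
    have hj := j.val_lt
    have hcast : i - j = 1 ↔ ((i.val : ℕ) : ZMod m) = ((j.val + 1 : ℕ) : ZMod m) := by
      rw [sub_eq_iff_eq_add']
      simp
    rw [hcast, ZMod.natCast_eq_natCast_iff', Nat.mod_eq_of_lt hi]
    rcases (Nat.succ_le_of_lt hj).lt_or_eq with h | h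
    · rw [Nat.mod_eq_of_lt h]
      omega
    · have h' : j.val + 1 = m := h
      rw [h', Nat.mod_self]
      omega
  refine ⟨fun i j hij ↦ ?_, fun i j ↦ ?_⟩
  · apply ZMod.val_injective
    rcases lt_trichotomy i.val j.val with h | h | h
    · exact absurd hij (hinj _ _ h j.val_lt)
    · exact h
    · exact absurd hij.symm (hinj _ _ h i.val_lt)
  · have hi := i.val_lt
    have hj := j.val_lt
    rw [hsub, hsub]
    rcases lt_trichotomy i.val j.val with h | h | h
    · rw [hadj _ _ h hj]
      omega
    · simp only [h, G.irrefl, false_iff]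
      omega
    · rw [G.adj_comm, hadj _ _ h hi]
      omega

/-- In a graph without induced cycles of length at least 4, two distinct nonadjacent neighbors
`p`, `q` of `z` are not joined by a walk whose inner vertices are distinct from and not adjacent
to `z`. -/
lemma not_reachable_restrictTo {V : Type*} {G : SimpleGraph V}
    (hchordal : ∀ k : ℕ, 4 ≤ k → ∀ v : ZMod k → V, ¬ IsInducedCycle G k v)
    {p q z : V} (hzp : G.Adj z p) (hzq : G.Adj z q) (hpq : p ≠ q) (hnadj : ¬ G.Adj p q)
    {T : Set V} (hT : ∀ s ∈ T, s = p ∨ s = q ∨ (s ≠ z ∧ ¬ G.Adj z s)) :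
    ¬ (G.restrictTo T).Reachable p q := by
  intro hr
  obtain ⟨w, hw⟩ := hr.exists_walk_length_eq_dist
  have hpath := w.isPath_of_length_eq_dist hw
  have hmem : ∀ i ≤ w.length, w.getVert i ∈ T := by
    have hpos : 0 < w.length := by
      rw [hw]
      exact hr.pos_dist_of_ne hpq
    intro i hi
    rcases hi.lt_or_eq with h | h
    · exact (w.adj_getVert_succ h).1
    · obtain ⟨j, hj⟩ : ∃ j, w.length = j + 1 := ⟨w.length - 1, by omega⟩
      rw [h, hj]
      exact (w.adj_getVert_succ (i := j) (by omega)).2.1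
  have hinj {i j : ℕ} (hij : i < j) (hj : j ≤ w.length) : w.getVert i ≠ w.getVert j :=
    fun h ↦ hij.ne (hpath.getVert_injOn (by simp; omega) (by simpa using hj) h)
  have hadj {i j : ℕ} (hij : i < j) (hj : j ≤ w.length) :
      G.Adj (w.getVert i) (w.getVert j) ↔ j = i + 1 := by
    constructor
    · intro h
      have h' : (G.restrictTo T).Adj (w.getVert i) (w.getVert j) :=
        ⟨hmem i (by omega), hmem j hj, h⟩
      have := SimpleGraph.dist_le ((w.take i).append (.cons h' (w.drop j)))
      simp only [SimpleGraph.Walk.length_append, SimpleGraph.Walk.length_cons,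
        SimpleGraph.Walk.take_length, SimpleGraph.Walk.drop_length] at this
      omega
    · rintro rfl
      exact (w.adj_getVert_succ (by omega)).2.2
  have hne {i : ℕ} (hi : i ≤ w.length) : w.getVert i ≠ z := by
    rcases hT _ (hmem i hi) with h | h | h
    · rw [h]
      exact hzp.ne'
    · rw [h]
      exact hzq.ne'
    · exact h.1
  have hz {i : ℕ} (hi : i ≤ w.length) : G.Adj (w.getVert i) z ↔ i = 0 ∨ i = w.length := by
    constructor
    · intro h
      rcases hT _ (hmem i hi) with h' | h' | h'
      · left
        by_contra h0
        exact hinj (Nat.pos_of_ne_zero h0) hi (by simp [h'])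
      · right
        by_contra h0
        exact hinj (lt_of_le_of_ne hi h0) le_rfl (by simp [h'])
      · exact absurd h.symm h'.2
    · rintro (rfl | rfl)
      · simpa using hzp.symm
      · simpa using hzq.symm
  have hlen : 2 ≤ w.length := by
    by_contra! h
    rcases Nat.le_one_iff_eq_zero_or_eq_one.1 (Nat.le_of_lt_succ h) with h | h
    · exact hpq (SimpleGraph.Walk.eq_of_length_eq_zero h)
    · have := (hadj (i := 0) (j := w.length) (by omega) le_rfl).2 (by omega)
      exact hnadj (by simpa using this)
  refine hchordal (w.length + 2) (by omega) _
    (isInducedCycle_of_nat (c := fun i ↦ if i ≤ w.length then w.getVert i else z) (by omega)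
      (fun i j hij hj ↦ ?_) (fun i j hij hj ↦ ?_))
  · have hi : i ≤ w.length := by omega
    by_cases hj' : j ≤ w.length
    · simpa [hi, hj'] using hinj hij hj'
    · simpa [hi, hj'] using hne hi
  · have hi : i ≤ w.length := by omega
    by_cases hj' : j ≤ w.length
    · simp only [hi, hj', if_true, hadj hij hj']
      omega
    · simp only [hi, hj', if_true, if_false, hz hi]
      omega

/-- A vertex at distance `d + 1` from `r` has a neighbor at distance `d` from `r`. -/
lemma SimpleGraph.Connected.exists_adj_dist_eq {V : Type*} {G : SimpleGraph V}
    (hconn : G.Connected) {x r : V} {d : ℕ} (hx : G.dist x r = d + 1) :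
    ∃ y, G.Adj x y ∧ G.dist y r = d := by
  obtain ⟨w, hw⟩ := hconn.exists_walk_length_eq_dist x r
  cases w with
  | nil => simp at hx
  | @cons _ y _ h w' =>
    have h1 := SimpleGraph.dist_le w'
    have h2 := hconn.dist_triangle (u := x) (v := y) (w := r)
    rw [SimpleGraph.dist_eq_one_iff_adj.2 h] at h2
    rw [SimpleGraph.Walk.length_cons] at hw
    exact ⟨y, h, by omega⟩

lemma SimpleGraph.Connected.dist_le_dist_add_one {V : Type*} {G : SimpleGraph V}
    (hconn : G.Connected) {x y : V} (h : G.Adj x y) (r : V) : G.dist x r ≤ G.dist y r + 1 := by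
  have := hconn.dist_triangle (u := x) (v := y) (w := r)
  rw [SimpleGraph.dist_eq_one_iff_adj.2 h] at this
  omega

/-- If `T` contains all vertices at distance less than `d` from `r`, then every vertex of `T` at
distance `d` from `r` can be joined to `r` inside `T`. -/
lemma SimpleGraph.Connected.reachable_restrictTo {V : Type*} {G : SimpleGraph V}
    (hconn : G.Connected) {r : V} {T : Set V} {d : ℕ} (hT : ∀ s, G.dist s r < d → s ∈ T)
    {x : V} (hx : x ∈ T) (hd : G.dist x r = d) : (G.restrictTo T).Reachable x r := by
  induction d generalizing x with
  | zero => exact hconn.dist_eq_zero_iff.1 hd ▸ .rfl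
  | succ d ih =>
    obtain ⟨y, hxy, hy⟩ := hconn.exists_adj_dist_eq hd
    have hyT : y ∈ T := hT y (by omega)
    have hadj : (G.restrictTo T).Adj x y := ⟨hx, hyT, hxy⟩
    exact hadj.reachable.trans (ih (fun s hs ↦ hT s (by omega)) hyT hy)

section Layers

variable {V : Type*} {G : SimpleGraph V} {r : V} {d : ℕ}

/-- In a chordal graph, two vertices at distance `d` from `r` with a common neighbor at distance
`d + 1` are equal or adjacent. -/
lemma eq_or_adj_of_common_neighbor (hconn : G.Connected)
    (hchordal : ∀ k : ℕ, 4 ≤ k → ∀ v : ZMod k → V, ¬ IsInducedCycle G k v)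
    {p q z : V} (hp : G.dist p r = d) (hq : G.dist q r = d) (hz : G.dist z r = d + 1)
    (hzp : G.Adj z p) (hzq : G.Adj z q) : p = q ∨ G.Adj p q := by
  by_contra! h
  let T : Set V := {s | s = p ∨ s = q ∨ (s ≠ z ∧ ¬ G.Adj z s)}
  have hT : ∀ s, G.dist s r < d → s ∈ T := by
    refine fun s hs ↦ .inr (.inr ⟨?_, fun hzs ↦ ?_⟩)
    · rintro rfl
      omega
    · have := hconn.dist_le_dist_add_one hzs r
      omega
  exact not_reachable_restrictTo hchordal hzp hzq h.1 h.2 (T := T) (fun _ hs ↦ hs)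
    ((hconn.reachable_restrictTo hT (.inl rfl) hp).trans
      (hconn.reachable_restrictTo hT (.inr (.inl rfl)) hq).symm)

/-- In a chordal graph, two adjacent vertices at distance `d + 1` from `r` have a common neighbor
at distance `d` from `r`. -/
lemma exists_common_neighbor (hconn : G.Connected)
    (hchordal : ∀ k : ℕ, 4 ≤ k → ∀ v : ZMod k → V, ¬ IsInducedCycle G k v)
    {a b : V} (ha : G.dist a r = d + 1) (hb : G.dist b r = d + 1) (hab : G.Adj a b) :
    ∃ c, G.Adj a c ∧ G.Adj b c ∧ G.dist c r = d := by
  by_contra! h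
  obtain ⟨w, haw, hw⟩ := hconn.exists_adj_dist_eq ha
  obtain ⟨v, hbv, hv⟩ := hconn.exists_adj_dist_eq hb
  let T : Set V := {s | s = w ∨ s = b ∨ (s ≠ a ∧ ¬ G.Adj a s)}
  have hT : ∀ s, G.dist s r < d → s ∈ T := by
    refine fun s hs ↦ .inr (.inr ⟨?_, fun has ↦ ?_⟩)
    · rintro rfl
      omega
    · have := hconn.dist_le_dist_add_one has r
      omega
  have hvT : v ∈ T := by
    refine .inr (.inr ⟨?_, fun hav ↦ h v hav hbv hv⟩)
    rintro rfl
    omega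
  have hbT : b ∈ T := .inr (.inl rfl)
  have hbv' : (G.restrictTo T).Adj b v := ⟨hbT, hvT, hbv⟩
  have hwb : w ≠ b := by
    rintro rfl
    omega
  exact not_reachable_restrictTo hchordal haw hab hwb (fun hwb ↦ h w haw hwb.symm hw) (T := T)
    (fun _ hs ↦ hs)
    (((hconn.reachable_restrictTo hT (.inl rfl) hw).trans
      (hconn.reachable_restrictTo hT hvT hv).symm).trans hbv'.symm.reachable)

end Layers

/-- A connected chordal (claw, bull)-free graph with three pairwise nonadjacent vertices has two
vertices at distance at least 3. -/
lemma exists_three_le_dist {V : Type*} {G : SimpleGraph V}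
    (hconn : G.Connected) (hclaw : ClawFree G) (hbull : BullFree G)
    (hchordal : ∀ k : ℕ, 4 ≤ k → ∀ v : ZMod k → V, ¬ IsInducedCycle G k v)
    (hindep : ∃ a b c : V, a ≠ b ∧ a ≠ c ∧ b ≠ c ∧
      ¬ G.Adj a b ∧ ¬ G.Adj a c ∧ ¬ G.Adj b c) : ∃ x y, 3 ≤ G.dist x y := by
  by_contra! hdist
  obtain ⟨a, b, c, hab, hac, hbc, nab, nac, nbc⟩ := hindep
  have common {x y : V} (hxy : x ≠ y) (h : ¬ G.Adj x y) : ∃ m, G.Adj m x ∧ G.Adj m y := by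
    have h1 := hconn.one_lt_dist_of_ne_of_not_adj hxy h
    have h2 := hdist x y
    obtain ⟨m, hxm, hm⟩ := hconn.exists_adj_dist_eq (x := x) (r := y) (d := 1) (by omega)
    exact ⟨m, hxm.symm, SimpleGraph.dist_eq_one_iff_adj.1 hm⟩
  have noclaw {v : V} : ¬ (G.Adj v a ∧ G.Adj v b ∧ G.Adj v c) := fun h ↦
    hclaw ⟨v, a, b, c, hab, hac, hbc, h.1, h.2.1, h.2.2, nab, nac, nbc⟩
  obtain ⟨x, hxa, hxb⟩ := common hab nab
  obtain ⟨y, hyb, hyc⟩ := common hbc nbc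
  obtain ⟨z, hza, hzc⟩ := common hac nac
  have nxc : ¬ G.Adj x c := fun h ↦ noclaw ⟨hxa, hxb, h⟩
  have nya : ¬ G.Adj y a := fun h ↦ noclaw ⟨h, hyb, hyc⟩
  have nzb : ¬ G.Adj z b := fun h ↦ noclaw ⟨hza, h, hzc⟩
  by_cases hxz : G.Adj x z
  · refine hbull ⟨x, z, a, b, c, ?_, ?_, hab, hac, hbc, hxz, hza, hxa.symm, hxb, hzc, nzb, nab,
      nxc, nac, nbc⟩
    · rintro rfl
      exact nac hxa.symm
    · rintro rfl
      exact nab hza.symm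
  · let T : Set V := {s | s = x ∨ s = z ∨ (s ≠ a ∧ ¬ G.Adj a s)}
    have step {s t : V} (hs : s ∈ T) (ht : t ∈ T) (h : G.Adj s t) :
        (G.restrictTo T).Reachable s t :=
      SimpleGraph.Adj.reachable (G := G.restrictTo T) ⟨hs, ht, h⟩
    have hx : x ∈ T := .inl rfl
    have hz : z ∈ T := .inr (.inl rfl)
    have hb : b ∈ T := .inr (.inr ⟨hab.symm, nab⟩)
    have hc : c ∈ T := .inr (.inr ⟨hac.symm, nac⟩)
    have hy : y ∈ T := .inr (.inr
      ⟨by rintro rfl; exact nab hyb, fun h ↦ nya h.symm⟩)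
    refine not_reachable_restrictTo hchordal hxa.symm hza.symm ?_ hxz (T := T) (fun _ hs ↦ hs)
      ((step hx hb hxb).trans ((step hb hy hyb.symm).trans
        ((step hy hc hyc).trans (step hc hz hzc.symm))))
    rintro rfl
    exact nxc hzc

/-- In a connected (claw, bull)-free graph `G` with no induced cycle of length at least 4
and with independence number at least 3: if `d(v₀, vₖ) = diam G` and `v₁` is a neighbor of
`v₀` with `d(v₁, vₖ) = diam G - 1`, then every neighbor `u ≠ v₁` of `v₀` is adjacent to
`v₁`. -/
theorem neighbors_adj_to_v1 {V : Type*} [Fintype V] (G : SimpleGraph V)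
    (hconn : G.Connected) (hclaw : ClawFree G) (hbull : BullFree G)
    (hchordal : ∀ k : ℕ, 4 ≤ k → ∀ v : ZMod k → V, ¬ IsInducedCycle G k v)
    (hindep : ∃ a b c : V, a ≠ b ∧ a ≠ c ∧ b ≠ c ∧
      ¬ G.Adj a b ∧ ¬ G.Adj a c ∧ ¬ G.Adj b c)
    (k : ℕ) (hk : k = G.diam)
    (v0 vk v1 : V) (h0k : G.dist v0 vk = k)
    (h01 : G.Adj v0 v1) (h1k : G.dist v1 vk = k - 1) :
    ∀ u : V, G.Adj v0 u → u ≠ v1 → G.Adj u v1 := by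
  intro u h0u hu1
  by_contra hn
  have hle (x y : V) : G.dist x y ≤ k := by
    have : Nonempty V := ⟨v0⟩
    exact hk ▸ SimpleGraph.dist_le_diam (SimpleGraph.connected_iff_ediam_ne_top.1 hconn)
  obtain ⟨s, t, hst⟩ := exists_three_le_dist hconn hclaw hbull hchordal hindep
  obtain ⟨d, rfl⟩ : ∃ d, k = d + 3 := ⟨k - 3, by have := hle s t; omega⟩
  have h1 : G.dist v1 vk = d + 2 := by omega
  have hu : G.dist u vk = d + 2 ∨ G.dist u vk = d + 3 := by
    have := hle u vk
    have := hconn.dist_le_dist_add_one h0u vk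
    omega
  rcases hu with hu | hu
  · exact (eq_or_adj_of_common_neighbor hconn hchordal hu h1 h0k h0u h01).elim hu1 hn
  obtain ⟨c, huc, h0c, hc⟩ := exists_common_neighbor hconn hchordal hu h0k h0u.symm
  have h1c : G.Adj v1 c := by
    refine (eq_or_adj_of_common_neighbor hconn hchordal h1 hc h0k h01 h0c).resolve_left ?_
    rintro rfl
    exact hn huc
  obtain ⟨w, hcw, h1w, hw⟩ := exists_common_neighbor hconn hchordal hc h1 h1c.symm
  obtain ⟨x, hwx, hx⟩ := hconn.exists_adj_dist_eq hw
  have far {y z : V} (h : G.dist z vk + 2 ≤ G.dist y vk) : y ≠ z ∧ ¬ G.Adj y z := by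
    refine ⟨?_, fun hyz ↦ ?_⟩
    · rintro rfl
      omega
    · have := hconn.dist_le_dist_add_one hyz vk
      omega
  have huw := far (y := u) (z := w) (by omega)
  have hux := far (y := u) (z := x) (by omega)
  have hcx := far (y := c) (z := x) (by omega)
  have h1x := far (y := v1) (z := x) (by omega)
  exact hbull ⟨c, w, v1, u, x, hcx.1, huw.1.symm, hu1.symm, h1x.1, hux.1, hcw, h1w.symm, h1c,
    huc.symm, hwx, fun h ↦ huw.2 h.symm, fun h ↦ hn h.symm, hcx.2, h1x.2, hux.2⟩
end

section
/- Let G be a finite connected graph that is claw-free and bull-free, contains no induced cycle of length at least 4, and has independence number at least 3 (there exist three pairwise nonadjacent distinct vertices). Let k = diam(G) and let v_0 be a vertex for which there exists a vertex at distance k from v_0. Then the neighborhood of v_0 is a clique: any two distinct neighbors of v_0 are adjacent. -/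
namespace SimpleGraph

variable {V : Type*} {G : SimpleGraph V}

/-- The spanning subgraph of `G` keeping exactly the edges with both ends in `S`. -/
def restrictTo_s13 (G : SimpleGraph V) (S : Set V) : SimpleGraph V where
  Adj a b := G.Adj a b ∧ a ∈ S ∧ b ∈ S
  symm := ⟨fun _ _ h => ⟨h.1.symm, h.2.2, h.2.1⟩⟩
  loopless := ⟨fun _ h => G.loopless.irrefl _ h.1⟩

theorem dist_getVert_of_length_eq_dist {u v : V} (p : G.Walk u v) (hp : p.length = G.dist u v)
    {i j : ℕ} (hij : i ≤ j) (hj : j ≤ p.length) :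
    G.dist (p.getVert i) (p.getVert j) = j - i := by
  have h₁ : G.dist u (p.getVert i) ≤ i := (dist_le (p.take i)).trans (by simp)
  have h₂ : G.dist (p.getVert j) v ≤ p.length - j := (dist_le (p.drop j)).trans (by simp)
  have hr : G.Reachable u (p.getVert i) := ⟨p.take i⟩
  have hr' : G.Reachable u (p.getVert j) := ⟨p.take j⟩
  have h₃ : G.dist (p.getVert i) (p.getVert j) ≤ j - i := by
    have := dist_le ((p.drop i).take (j - i))
    simp only [Walk.drop_getVert, Walk.take_length] at this
    rw [Nat.add_sub_cancel' hij] at this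
    omega
  have hr'' : G.Reachable (p.getVert i) v := ⟨p.drop i⟩
  have h₄ := hr.dist_triangle_left v
  have h₅ := (hr.symm.trans hr').dist_triangle_left v
  omega

/-- A vertex together with an induced path that it meets only at the two ends forms an
induced cycle. -/
theorem isInducedCycle_of_path {c : V} {n : ℕ} (hn : 2 ≤ n) (f : ℕ → V)
    (hc : ∀ i ≤ n, f i ≠ c) (hinj : ∀ i ≤ n, ∀ j ≤ n, f i = f j → i = j)
    (hadj : ∀ i ≤ n, ∀ j ≤ n, (G.Adj (f i) (f j) ↔ i + 1 = j ∨ j + 1 = i))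
    (hcadj : ∀ i ≤ n, (G.Adj c (f i) ↔ i = 0 ∨ i = n)) :
    IsInducedCycle G (n + 2)
      (fun i : ZMod (n + 2) => if i.val = 0 then c else f (i.val - 1)) := by
  have hlt (i : ZMod (n + 2)) : i.val < n + 2 := ZMod.val_lt i
  have hsub (i j : ZMod (n + 2)) :
      i - j = 1 ↔ (j.val = n + 1 ∧ i.val = 0) ∨ i.val = j.val + 1 := by
    have : Fact (1 < n + 2) := ⟨by omega⟩
    rw [sub_eq_iff_eq_add, ← (ZMod.val_injective (n + 2)).eq_iff, ZMod.val_add, ZMod.val_one]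
    have hi := hlt i
    have hj := hlt j
    by_cases h : j.val = n + 1
    · rw [h, show 1 + (n + 1) = n + 2 by omega, Nat.mod_self]
      omega
    · rw [Nat.mod_eq_of_lt (by omega)]
      omega
  constructor
  · intro i j hij
    apply ZMod.val_injective
    have hi := hlt i
    have hj := hlt j
    dsimp only at hij
    split_ifs at hij with h₁ h₂ h₂
    · omega
    · exact absurd hij.symm (hc _ (by omega))
    · exact absurd hij (hc _ (by omega))
    · have := hinj _ (by omega) _ (by omega) hij
      omega
  · intro i j
    rw [hsub, hsub]
    have hi := hlt i
    have hj := hlt j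
    dsimp only
    split_ifs with h₁ h₂ h₂
    · simp only [SimpleGraph.irrefl, false_iff]
      omega
    · rw [hcadj _ (by omega)]
      omega
    · rw [G.adj_comm, hcadj _ (by omega)]
      omega
    · rw [hadj _ (by omega) _ (by omega)]
      omega

/-- In a graph without long induced cycles, two neighbors of `c` are adjacent if they are
joined by a walk that avoids `c` and all its other neighbors. -/
theorem adj_of_reachable_restrictTo
    (hchordal : ∀ k : ℕ, 4 ≤ k → ∀ v : ZMod k → V, ¬ IsInducedCycle G k v)
    {c u u' : V} {S : Set V} (hu : G.Adj c u) (hu' : G.Adj c u') (hne : u ≠ u')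
    (hS : ∀ z ∈ S, z ≠ c ∧ (G.Adj c z → z = u ∨ z = u'))
    (hr : (G.restrictTo_s13 S).Reachable u u') : G.Adj u u' := by
  by_contra hnadj
  obtain ⟨p, hp⟩ := hr.exists_walk_length_eq_dist
  have hn : 2 ≤ p.length := by
    by_contra hlt
    obtain h | h : p.length = 0 ∨ p.length = 1 := by omega
    · exact hne (Walk.eq_of_length_eq_zero h)
    · exact hnadj (Walk.adj_of_length_eq_one h).1
  have hmem : ∀ i ≤ p.length, p.getVert i ∈ S := by
    intro i hi
    obtain h | h := Nat.lt_or_eq_of_le hi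
    · exact (p.adj_getVert_succ h).2.1
    · have := p.adj_getVert_succ (i := i - 1) (by omega)
      rw [Nat.sub_add_cancel (by omega)] at this
      exact this.2.2
  have hinj : ∀ i ≤ p.length, ∀ j ≤ p.length, p.getVert i = p.getVert j → i = j := by
    intro i hi j hj h
    obtain hij | hij := le_total i j
    · have := dist_getVert_of_length_eq_dist p hp hij hj
      rw [h, dist_self] at this
      omega
    · have := dist_getVert_of_length_eq_dist p hp hij hi
      rw [h, dist_self] at this
      omega
  refine hchordal _ (by omega) _ (isInducedCycle_of_path (c := c) hn p.getVert
    (fun i hi => (hS _ (hmem i hi)).1) hinj ?_ ?_)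
  · intro i hi j hj
    have key : G.Adj (p.getVert i) (p.getVert j) ↔
        (G.restrictTo_s13 S).dist (p.getVert i) (p.getVert j) = 1 := by
      rw [dist_eq_one_iff_adj]
      exact ⟨fun h => ⟨h, hmem i hi, hmem j hj⟩, fun h => h.1⟩
    rw [key]
    obtain hij | hij := le_total i j
    · rw [dist_getVert_of_length_eq_dist p hp hij hj]
      omega
    · rw [dist_comm, dist_getVert_of_length_eq_dist p hp hij hi]
      omega
  · intro i hi
    constructor
    · intro h
      obtain h | h := (hS _ (hmem i hi)).2 h
      · exact Or.inl (hinj _ hi _ (Nat.zero_le _) (by simpa using h))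
      · exact Or.inr (hinj _ hi _ le_rfl (by simpa using h))
    · rintro (rfl | rfl)
      · simpa using hu
      · simpa using hu'

theorem Connected.exists_adj_dist_eq_s13 (hconn : G.Connected) {x w : V} {n : ℕ}
    (h : G.dist x w = n + 1) : ∃ y, G.Adj x y ∧ G.dist y w = n := by
  obtain ⟨p, hp⟩ := hconn.exists_walk_length_eq_dist x w
  cases p with
  | nil => simp at h
  | @cons _ y _ hxy q =>
    refine ⟨y, hxy, ?_⟩
    have h₁ := dist_le q
    have h₂ := hconn.dist_triangle (u := x) (v := y) (w := w)
    have h₃ := dist_eq_one_iff_adj.2 hxy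
    simp only [Walk.length_cons] at hp
    omega

theorem Connected.reachable_restrictTo_s13 (hconn : G.Connected) {w : V} {S : Set V} {n : ℕ} {x : V}
    (hx : x ∈ S) (hn : G.dist x w = n) (hS : ∀ z, G.dist z w < n → z ∈ S) :
    (G.restrictTo_s13 S).Reachable x w := by
  induction n generalizing x with
  | zero =>
    rw [hconn.dist_eq_zero_iff] at hn
    rw [hn]
  | succ n ih =>
    obtain ⟨y, hxy, hy⟩ := hconn.exists_adj_dist_eq_s13 hn
    have hyS := hS y (by omega)
    have hadj : (G.restrictTo_s13 S).Adj x y := ⟨hxy, hx, hyS⟩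
    exact hadj.reachable.trans (ih hyS hy fun z hz => hS z (by omega))

/-- Three independent vertices at pairwise distance two would give a 3-sun, which contains
a bull. -/
theorem exists_two_lt_dist (hconn : G.Connected) (hclaw : ClawFree G) (hbull : BullFree G)
    (hchordal : ∀ k : ℕ, 4 ≤ k → ∀ v : ZMod k → V, ¬ IsInducedCycle G k v)
    (hindep : ∃ a b c : V, a ≠ b ∧ a ≠ c ∧ b ≠ c ∧
      ¬ G.Adj a b ∧ ¬ G.Adj a c ∧ ¬ G.Adj b c) :
    ∃ x y, 2 < G.dist x y := by
  by_contra! hdist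
  have hcommon {x y : V} (hne : x ≠ y) (hadj : ¬ G.Adj x y) : ∃ z, G.Adj x z ∧ G.Adj z y := by
    have h₀ : G.dist x y ≠ 0 := fun h => hne (hconn.dist_eq_zero_iff.1 h)
    have h₁ : G.dist x y ≠ 1 := fun h => hadj (dist_eq_one_iff_adj.1 h)
    have h₂ := hdist x y
    obtain ⟨z, hxz, hz⟩ := hconn.exists_adj_dist_eq_s13 (n := 1) (show G.dist x y = 1 + 1 by omega)
    exact ⟨z, hxz, dist_eq_one_iff_adj.1 hz⟩
  have hmiddle {a b c p q r : V} (hab : a ≠ b) (hac : a ≠ c) (hbc : b ≠ c) (nab : ¬ G.Adj a b)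
      (nac : ¬ G.Adj a c) (nbc : ¬ G.Adj b c) (hap : G.Adj a p) (hpb : G.Adj p b)
      (hbq : G.Adj b q) (hqc : G.Adj q c) (har : G.Adj a r) (hrc : G.Adj r c) :
      G.Adj p r := by
    have npc : ¬ G.Adj p c := fun h => hclaw ⟨p, a, b, c, hab, hac, hbc, hap.symm, hpb, h,
      nab, nac, nbc⟩
    have naq : ¬ G.Adj a q := fun h => hclaw ⟨q, a, b, c, hab, hac, hbc, h.symm, hbq.symm, hqc,
      nab, nac, nbc⟩
    have hpr : p ≠ r := by
      rintro rfl
      exact npc hrc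
    refine adj_of_reachable_restrictTo hchordal hap har hpr
      (S := {z | z ≠ a ∧ (G.Adj a z → z = p ∨ z = r)}) (fun z hz => hz) ?_
    have hqa : q ≠ a := by
      rintro rfl
      exact nac hqc
    have h₁ : (G.restrictTo_s13 {z | z ≠ a ∧ (G.Adj a z → z = p ∨ z = r)}).Adj p b :=
      ⟨hpb, ⟨hap.ne', fun _ => Or.inl rfl⟩, ⟨hab.symm, fun h => absurd h nab⟩⟩
    have h₂ : (G.restrictTo_s13 {z | z ≠ a ∧ (G.Adj a z → z = p ∨ z = r)}).Adj b q :=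
      ⟨hbq, h₁.2.2, ⟨hqa, fun h => absurd h naq⟩⟩
    have h₃ : (G.restrictTo_s13 {z | z ≠ a ∧ (G.Adj a z → z = p ∨ z = r)}).Adj q c :=
      ⟨hqc, h₂.2.2, ⟨hac.symm, fun h => absurd h nac⟩⟩
    have h₄ : (G.restrictTo_s13 {z | z ≠ a ∧ (G.Adj a z → z = p ∨ z = r)}).Adj c r :=
      ⟨hrc.symm, h₃.2.2, ⟨har.ne', fun _ => Or.inr rfl⟩⟩
    exact h₁.reachable.trans (h₂.reachable.trans (h₃.reachable.trans h₄.reachable))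
  obtain ⟨a, b, c, hab, hac, hbc, nab, nac, nbc⟩ := hindep
  obtain ⟨p, hap, hpb⟩ := hcommon hab nab
  obtain ⟨q, hbq, hqc⟩ := hcommon hbc nbc
  obtain ⟨r, har, hrc⟩ := hcommon hac nac
  have hpr : G.Adj p r := hmiddle hab hac hbc nab nac nbc hap hpb hbq hqc har hrc
  have npc : ¬ G.Adj p c := fun h => hclaw ⟨p, a, b, c, hab, hac, hbc, hap.symm, hpb, h,
    nab, nac, nbc⟩
  have nqa : ¬ G.Adj q a := fun h => hclaw ⟨q, a, b, c, hab, hac, hbc, h, hbq.symm, hqc,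
    nab, nac, nbc⟩
  have nrb : ¬ G.Adj r b := fun h => hclaw ⟨r, a, b, c, hab, hac, hbc, har.symm, h, hrc,
    nab, nac, nbc⟩
  refine hbull ⟨p, r, a, b, c, ?_, ?_, hab, hac, hbc, hpr, har.symm, hap, hpb, hrc, nrb, nab, npc,
    nac, nbc⟩
  · rintro rfl
    exact nac hap
  · rintro rfl
    exact nab har

theorem Adj.dist_le_add_one (hconn : G.Connected) {x y : V} (h : G.Adj x y) (w : V) :
    G.dist x w ≤ G.dist y w + 1 := by
  have h₂ := hconn.dist_triangle (u := x) (v := y) (w := w)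
  have h₃ := dist_eq_one_iff_adj.2 h
  omega

/-- Two neighbors `u`, `u'` of `v` are adjacent if `u` starts a geodesic from `v` to `w`, and
`u'` is, or has as a neighbor outside the closed neighborhood of `v`, a vertex closer to `w`
than `v`. -/
theorem adj_of_dist_lt (hconn : G.Connected)
    (hchordal : ∀ k : ℕ, 4 ≤ k → ∀ v : ZMod k → V, ¬ IsInducedCycle G k v)
    {v u u' x w : V} {n : ℕ} (hv : G.dist v w = n + 1) (hu : G.Adj v u) (hu' : G.Adj v u')
    (hne : u ≠ u') (hun : G.dist u w = n) (hx : G.dist x w = n)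
    (hxu' : x = u' ∨ G.Adj x u' ∧ ¬ G.Adj v x) : G.Adj u u' := by
  set S : Set V := {z | z ≠ v ∧ (G.Adj v z → z = u ∨ z = u')} with hSdef
  have hS : ∀ z, G.dist z w < n → z ∈ S := by
    refine fun z hz => ⟨?_, fun h => ?_⟩
    · rintro rfl
      omega
    · have := h.dist_le_add_one hconn w
      omega
  have hxS : x ∈ S := by
    refine ⟨?_, fun h => ?_⟩
    · rintro rfl
      omega
    · exact hxu'.elim Or.inr fun h' => absurd h h'.2
  have hu'S : u' ∈ S := ⟨hu'.ne', fun _ => Or.inr rfl⟩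
  refine adj_of_reachable_restrictTo hchordal hu hu' hne (S := S) (fun z hz => hz) ?_
  have h₁ := hconn.reachable_restrictTo_s13 (S := S) ⟨hu.ne', fun _ => Or.inl rfl⟩ hun hS
  have h₂ := hconn.reachable_restrictTo_s13 hxS hx hS
  have h₃ : (G.restrictTo_s13 S).Reachable x u' := by
    obtain rfl | h := hxu'
    · rfl
    · exact Adj.reachable ⟨h.1, hxS, hu'S⟩
  exact h₁.trans (h₂.symm.trans h₃)

/-- If `w` is at distance at least three from `v` and no vertex is further from `w` than `v`,
then a neighbor of `v` starting a geodesic to `w` is adjacent to all other neighbors of `v`. -/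
theorem adj_of_dist_add_one_eq (hconn : G.Connected) (hclaw : ClawFree G) (hbull : BullFree G)
    (hchordal : ∀ k : ℕ, 4 ≤ k → ∀ v : ZMod k → V, ¬ IsInducedCycle G k v)
    {v w u u' : V} {n : ℕ} (hv : G.dist v w = n + 3) (hmax : ∀ z, G.dist z w ≤ n + 3)
    (hu : G.Adj v u) (hu' : G.Adj v u') (hne : u ≠ u') (hun : G.dist u w = n + 2) :
    G.Adj u u' := by
  by_contra hnadj
  have hd {a b : V} (h : G.Adj a b) := h.dist_le_add_one hconn w
  have hu'n : G.dist u' w = n + 3 := by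
    have h₁ : G.dist u' w ≠ n + 2 := fun h =>
      hnadj (adj_of_dist_lt hconn hchordal hv hu hu' hne hun h (Or.inl rfl))
    have := hd hu'
    have := hmax u'
    omega
  obtain ⟨x, hu'x, hx⟩ := hconn.exists_adj_dist_eq_s13 hu'n
  have hvx : G.Adj v x := by
    by_contra h
    exact hnadj (adj_of_dist_lt hconn hchordal hv hu hu' hne hun hx (Or.inr ⟨hu'x.symm, h⟩))
  have hux : u ≠ x := by
    rintro rfl
    exact hnadj hu'x.symm
  have aux : G.Adj u x := adj_of_dist_lt hconn hchordal hv hu hvx hux hun hx (Or.inl rfl)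
  obtain ⟨y, hxy, hy⟩ := hconn.exists_adj_dist_eq_s13 hx
  obtain ⟨z, hyz, hz⟩ := hconn.exists_adj_dist_eq_s13 hy
  have hfar {a b : V} (h : G.dist a w + 1 < G.dist b w) : ¬ G.Adj b a ∧ ¬ G.Adj a b ∧ b ≠ a := by
    refine ⟨fun h' => ?_, fun h' => ?_, ?_⟩
    · have := hd h'
      omega
    · have := hd h'.symm
      omega
    · rintro rfl
      omega
  have hyu' := hfar (a := y) (b := u') (by omega)
  have hzu' := hfar (a := z) (b := u') (by omega)
  have hzx := hfar (a := z) (b := x) (by omega)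
  have hzu := hfar (a := z) (b := u) (by omega)
  have huy : u ≠ y := by
    rintro rfl
    omega
  have auy : G.Adj u y := by
    by_contra h
    exact hclaw ⟨x, u, u', y, hne, huy, hyu'.2.2, aux.symm, hu'x.symm, hxy, hnadj, h, hyu'.1⟩
  exact hbull ⟨x, y, u, u', z, hzx.2.2, hyu'.2.2.symm, hne, hzu.2.2, hzu'.2.2, hxy, auy.symm, aux,
    hu'x.symm, hyz, hyu'.2.1, hnadj, hzx.1, hzu.1, hzu'.1⟩

end SimpleGraph

/-- In a connected (claw, bull)-free graph with no induced cycle of length at least 4 and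
with independence number at least 3, the neighborhood of any vertex realizing the diameter
is a clique. -/
theorem neighborhood_is_clique {V : Type*} [Fintype V] (G : SimpleGraph V)
    (hconn : G.Connected) (hclaw : ClawFree G) (hbull : BullFree G)
    (hchordal : ∀ k : ℕ, 4 ≤ k → ∀ v : ZMod k → V, ¬ IsInducedCycle G k v)
    (hindep : ∃ a b c : V, a ≠ b ∧ a ≠ c ∧ b ≠ c ∧
      ¬ G.Adj a b ∧ ¬ G.Adj a c ∧ ¬ G.Adj b c)
    (k : ℕ) (hk : k = G.diam)
    (v0 : V) (hv0 : ∃ w : V, G.dist v0 w = k) :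
    ∀ u u' : V, G.Adj v0 u → G.Adj v0 u' → u ≠ u' → G.Adj u u' := by
  obtain ⟨w, hw⟩ := hv0
  have : Nonempty V := hconn.nonempty
  have hle (x y : V) : G.dist x y ≤ k :=
    hk ▸ SimpleGraph.dist_le_diam (SimpleGraph.connected_iff_ediam_ne_top.1 hconn)
  obtain ⟨a, b, hab⟩ := SimpleGraph.exists_two_lt_dist hconn hclaw hbull hchordal hindep
  obtain ⟨n, rfl⟩ : ∃ n, k = n + 3 := ⟨k - 3, by have := hle a b; omega⟩
  have hgeo {x y : V} (hx : G.Adj v0 x) (hy : G.Adj v0 y) (hne : x ≠ y)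
      (hd : G.dist x w = n + 2) : G.Adj x y :=
    SimpleGraph.adj_of_dist_add_one_eq hconn hclaw hbull hchordal hw (hle · w) hx hy hne hd
  intro u u' hu hu' hne
  obtain ⟨y, hvy, hy⟩ := hconn.exists_adj_dist_eq_s13 hw
  obtain ⟨z, hyz, hz⟩ := hconn.exists_adj_dist_eq_s13 hy
  by_contra hnadj
  have hun : G.dist u w ≠ n + 2 := fun h => hnadj (hgeo hu hu' hne h)
  have hu'n : G.dist u' w ≠ n + 2 := fun h => hnadj (hgeo hu' hu hne.symm h).symm
  have hyu : G.Adj y u := hgeo hvy hu (by rintro rfl; exact hun hy) hy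
  have hyu' : G.Adj y u' := hgeo hvy hu' (by rintro rfl; exact hu'n hy) hy
  have hfar {x : V} (hx : G.Adj v0 x) (hxn : G.dist x w ≠ n + 2) : ¬ G.Adj x z ∧ x ≠ z := by
    have h₁ := hx.dist_le_add_one hconn w
    refine ⟨fun h => ?_, ?_⟩
    · have := h.dist_le_add_one hconn w
      omega
    · rintro rfl
      omega
  exact hclaw ⟨y, u, u', z, hne, (hfar hu hun).2, (hfar hu' hu'n).2, hyu, hyu', hyz, hnadj,
    (hfar hu hun).1, (hfar hu' hu'n).1⟩
end

section
/- Let G be a finite graph that is claw-free and bull-free, let u_0 and u_1 be adjacent vertices of G, let U be the set of neighbors of u_0 other than u_1, and let H be the subgraph of G induced on the vertices not in U. For each i ≥ 0 let N_i be the set of vertices of H at distance exactly i from u_0 in H. Then for every i ≥ 1: any two distinct vertices of N_i are adjacent in G, and every vertex of N_i is adjacent in G to every vertex of N_{i−1}. -/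
theorem ClawFree.induce {V : Type*} {G : SimpleGraph V} (h : ClawFree G) (s : Set V) :
    ClawFree (G.induce s) := by
  rintro ⟨v, a, b, c, hab, hac, hbc, h'⟩
  exact h ⟨v, a, b, c, by simpa [Subtype.ext_iff] using hab, by simpa [Subtype.ext_iff] using hac,
    by simpa [Subtype.ext_iff] using hbc, by simpa using h'⟩

theorem BullFree.induce {V : Type*} {G : SimpleGraph V} (h : BullFree G) (s : Set V) :
    BullFree (G.induce s) := by
  rintro ⟨a, b, c, d, e, hae, hbd, hcd, hce, hde, h'⟩
  exact h ⟨a, b, c, d, e, by simpa [Subtype.ext_iff] using hae,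
    by simpa [Subtype.ext_iff] using hbd, by simpa [Subtype.ext_iff] using hcd,
    by simpa [Subtype.ext_iff] using hce, by simpa [Subtype.ext_iff] using hde,
    by simpa using h'⟩

namespace SimpleGraph

variable {W : Type*} {H : SimpleGraph W} {r : W}

/-- The set of vertices in the component of `r` at distance exactly `i` from `r`. -/
def distLevel (H : SimpleGraph W) (r : W) (i : ℕ) : Set W :=
  {x | H.Reachable r x ∧ H.dist r x = i}

theorem le_succ_of_adj_of_mem_distLevel {i j : ℕ} {x y : W} (hx : x ∈ H.distLevel r i)
    (hy : y ∈ H.distLevel r j) (h : H.Adj x y) : j ≤ i + 1 := by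
  obtain ⟨w, hw⟩ := hx.1.exists_walk_length_eq_dist
  have := dist_le (w.concat h)
  rw [Walk.length_concat, hw, hx.2, hy.2] at this
  exact this

theorem exists_adj_of_mem_distLevel_succ {i : ℕ} {x : W} (hx : x ∈ H.distLevel r (i + 1)) :
    ∃ p ∈ H.distLevel r i, H.Adj p x := by
  obtain ⟨w, hw⟩ := hx.1.symm.exists_walk_length_eq_dist
  rw [dist_comm, hx.2] at hw
  cases w with
  | nil => simp at hw
  | @cons _ p _ h q =>
    have hp : p ∈ H.distLevel r (H.dist r p) := ⟨q.reachable.symm, rfl⟩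
    have h₁ := le_succ_of_adj_of_mem_distLevel hp hx h.symm
    have h₂ := dist_le q
    rw [dist_comm] at h₂
    rw [Walk.length_cons] at hw
    exact ⟨p, ⟨hp.1, by omega⟩, h.symm⟩

theorem eq_of_mem_distLevel_zero {x : W} (hx : x ∈ H.distLevel r 0) : x = r :=
  (hx.1.dist_eq_zero_iff.mp hx.2).symm

/-- In a claw-free and bull-free graph, the distance levels from a vertex `r` with at most one
neighbour are cliques, and consecutive levels are completely joined. -/
theorem distLevel_isClique_and_joined (hclaw : ClawFree H) (hbull : BullFree H)
    (hr : ∀ x y, H.Adj r x → H.Adj r y → x = y) (i : ℕ) :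
    H.IsClique (H.distLevel r (i + 1)) ∧
      ∀ x ∈ H.distLevel r (i + 1), ∀ y ∈ H.distLevel r i, H.Adj x y := by
  induction i with
  | zero =>
    have root_adj : ∀ x ∈ H.distLevel r 1, H.Adj r x := by
      intro x hx
      obtain ⟨p, hp, hpx⟩ := exists_adj_of_mem_distLevel_succ hx
      rwa [← eq_of_mem_distLevel_zero hp]
    refine ⟨fun x hx y hy hne => (hne (hr x y (root_adj x hx) (root_adj y hy))).elim, ?_⟩
    intro x hx y hy
    rw [eq_of_mem_distLevel_zero hy]
    exact (root_adj x hx).symm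
  | succ i ih =>
    obtain ⟨clique, joined⟩ := ih
    have ne_of_lt {j k : ℕ} {x y : W} (hx : x ∈ H.distLevel r j) (hy : y ∈ H.distLevel r k)
        (h : j < k) : x ≠ y := by
      rintro rfl
      exact h.ne (hx.2.symm.trans hy.2)
    have not_adj {j k : ℕ} {x y : W} (hx : x ∈ H.distLevel r j) (hy : y ∈ H.distLevel r k)
        (h : j + 1 < k) : ¬ H.Adj x y := fun hxy =>
      (le_succ_of_adj_of_mem_distLevel hx hy hxy).not_gt h
    have joined' : ∀ x ∈ H.distLevel r (i + 1 + 1), ∀ y ∈ H.distLevel r (i + 1), H.Adj x y := by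
      intro x hx y hy
      by_contra hxy
      obtain ⟨p, hp, hpx⟩ := exists_adj_of_mem_distLevel_succ hx
      have hpy : p ≠ y := by
        rintro rfl
        exact hxy hpx.symm
      obtain ⟨q, hq, hqp⟩ := exists_adj_of_mem_distLevel_succ hp
      have hyq := joined y hy q hq
      cases i with
      | zero =>
        rw [eq_of_mem_distLevel_zero hq] at hqp hyq
        exact hpy (hr p y hqp hyq.symm)
      | succ k =>
        obtain ⟨t, ht, htq⟩ := exists_adj_of_mem_distLevel_succ hq
        exact hbull ⟨p, q, y, x, t, (ne_of_lt ht hp (by omega)).symm, ne_of_lt hq hx (by omega),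
          ne_of_lt hy hx (by omega), (ne_of_lt ht hy (by omega)).symm,
          (ne_of_lt ht hx (by omega)).symm, hqp.symm, hyq.symm, clique hy hp hpy.symm, hpx,
          htq.symm, not_adj hq hx (by omega), fun h => hxy h.symm,
          fun h => not_adj ht hp (by omega) h.symm, fun h => not_adj ht hy (by omega) h.symm,
          fun h => not_adj ht hx (by omega) h.symm⟩
    refine ⟨fun x hx y hy hne => ?_, joined'⟩
    by_contra hxy
    obtain ⟨p, hp, hpx⟩ := exists_adj_of_mem_distLevel_succ hx
    obtain ⟨q, hq, hqp⟩ := exists_adj_of_mem_distLevel_succ hp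
    exact hclaw ⟨p, x, y, q, hne, (ne_of_lt hq hx (by omega)).symm,
      (ne_of_lt hq hy (by omega)).symm, hpx, (joined' y hy p hp).symm, hqp.symm, hxy,
      fun h => not_adj hq hx (by omega) h.symm, fun h => not_adj hq hy (by omega) h.symm⟩

end SimpleGraph

/-- Let `G` be (claw, bull)-free, `u₀u₁` an edge, `U = N(u₀) \ {u₁}`, and `H` the subgraph
induced on the complement of `U`. With `Nᵢ` the set of vertices of `H` at distance exactly
`i` from `u₀` in `H` (within the component of `u₀`), each `Nᵢ` (`i ≥ 1`) is a clique in `G`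
and is completely joined to `Nᵢ₋₁` in `G`. -/
theorem levels_are_cliques_and_joined {V : Type*} [Fintype V] (G : SimpleGraph V)
    (hclaw : ClawFree G) (hbull : BullFree G)
    (u0 u1 : V) (h01 : G.Adj u0 u1)
    (s : Set V) (hs : s = {v : V | v ∉ G.neighborSet u0 \ {u1}})
    (u0' : s) (hu0' : (u0' : V) = u0)
    (N : ℕ → Set s)
    (hN : ∀ i : ℕ, N i =
      {x : s | (G.induce s).Reachable u0' x ∧ (G.induce s).dist u0' x = i}) :
    ∀ i : ℕ, 1 ≤ i →
      (∀ x ∈ N i, ∀ y ∈ N i, x ≠ y → G.Adj (x : V) (y : V)) ∧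
      (∀ x ∈ N i, ∀ y ∈ N (i - 1), G.Adj (x : V) (y : V)) := by
  intro i hi
  obtain ⟨i, rfl⟩ := Nat.exists_eq_add_of_le' hi
  have hr : ∀ x : s, (G.induce s).Adj u0' x → (x : V) = u1 := by
    intro x hx
    have hxs : (x : V) ∉ G.neighborSet u0 \ {u1} := hs.subset x.2
    by_contra hne
    exact hxs ⟨hu0' ▸ hx, hne⟩
  obtain ⟨clique, joined⟩ := SimpleGraph.distLevel_isClique_and_joined (hclaw.induce s)
    (hbull.induce s) (fun x y hx hy => Subtype.ext ((hr x hx).trans (hr y hy).symm)) i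
  rw [Nat.add_sub_cancel, hN, hN]
  exact ⟨fun x hx y hy hne => clique hx hy hne, fun x hx y hy => joined x hx y hy⟩
end

section
/- Every finite graph H that is an expansion of a cycle of length k ≥ 6 is claw-free and bull-free. That is, if there exists a surjective map f from the vertices of H onto ZMod k (k ≥ 6) such that distinct vertices x, y of H are adjacent if and only if f(x) = f(y) or f(x) − f(y) = ±1 in ZMod k, then H contains no induced claw and no induced bull. -/
/-- In `ZMod k` with `k ≥ 4`, pairwise equal or consecutive elements take at most two values. -/
theorem ZMod.eq_of_pairwise_consecutive {k : ℕ} (hk : 4 ≤ k) {x y z : ZMod k}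
    (hxy : x = y ∨ x - y = 1 ∨ y - x = 1) (hyz : y = z ∨ y - z = 1 ∨ z - y = 1)
    (hzx : z = x ∨ z - x = 1 ∨ x - z = 1) : x = y ∨ z = x ∨ z = y := by
  have h_one : (1 : ZMod k) ≠ 0 := fun h => by
    have := Nat.le_of_dvd one_pos ((ZMod.natCast_eq_zero_iff 1 k).1 (by exact_mod_cast h))
    omega
  have h_three : (3 : ZMod k) ≠ 0 := fun h => by
    have := Nat.le_of_dvd three_pos ((ZMod.natCast_eq_zero_iff 3 k).1 (by exact_mod_cast h))
    omega
  grind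

/-- Every expansion of a cycle of length `k ≥ 6` is claw-free and bull-free. -/
theorem cycleExpansion_clawFree_bullFree {V : Type*} [Fintype V] (H : SimpleGraph V)
    (k : ℕ) (hk : 6 ≤ k) (f : V → ZMod k) (hsurj : Function.Surjective f)
    (hadj : ∀ x y : V, x ≠ y →
      (H.Adj x y ↔ (f x = f y ∨ f x - f y = 1 ∨ f y - f x = 1))) :
    ClawFree H ∧ BullFree H := by
  have twin : ∀ {x y z : V}, y ≠ z → f x = f y → H.Adj x z → H.Adj y z := by
    intro x y z hyz hxy hxz
    rw [hadj y z hyz, ← hxy]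
    exact (hadj x z hxz.ne).1 hxz
  constructor
  · rintro ⟨v, a, b, c, hab, hac, hbc, va, vb, vc, nab, nac, nbc⟩
    have ha := (hadj v a va.ne).1 va
    have hb := (hadj v b vb.ne).1 vb
    have hc := (hadj v c vc.ne).1 vc
    rw [hadj a b hab] at nab
    rw [hadj a c hac] at nac
    rw [hadj b c hbc] at nbc
    grind
  · rintro ⟨a, b, c, d, e, hae, hbd, hcd, hce, -, ab, bc, ca, ad, be, nbd, ncd, nae, nce, -⟩
    rcases ZMod.eq_of_pairwise_consecutive (by omega) ((hadj a b ab.ne).1 ab)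
      ((hadj b c bc.ne).1 bc) ((hadj c a ca.ne).1 ca) with h | h | h
    · exact nbd (twin hbd h ad)
    · exact ncd (twin hcd h.symm ad)
    · exact nce (twin hce h.symm be)
end
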